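/- Energy estimate for divergence-free drift in the critical regime (Proposition 3.2): Let d ≥ 1, m ≥ 1, β := (m−1)/m, and let q̂₁ ∈ (1, ∞], q̂₂ ∈ (1, ∞) satisfy 2/q̂₁ + d/q̂₂ = 2; set q₁ := 2q̂₁/(q̂₁ − 1), q₂ := 2q̂₂/(q̂₂ − 1). There exists a constant C = C(m) such that: for every ρ ∈ (0, 1/2) and cylinder Q_ρ := K_ρ × (t₀, t₁] ⊆ Q₁, every C¹ divergence-free vector field B on Q₁, every positive classical solution v on Q_ρ with μ₊ := sup_{Q_ρ} v and μ₋ := inf_{Q_ρ} v, every k ∈ (μ₋, μ₊), and every smooth cutoff ζ on the closure of Q_ρ with 0 ≤ ζ ≤ 1 vanishing on the parabolic boundary, one has (with v₊ := max(v − μ₊ + k, 0)): μ₊^{−β} · sup_{t₀ ≤ t ≤ t₁} ∫_{K_ρ} v₊² ζ² dx + ∬_{Q_ρ} |∇(v₊ ζ)|² dx dt ≤ C k² (μ₊ − k)^{−β} ∬_{{v₊ > 0}} |ζ ∂_t ζ| dx dt + C k² ∬_{{v₊ > 0}} |∇ζ|² dx dt + C (μ₊ − k)^{−2β} ‖B‖²_{L^{2q̂₁}_t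 L^{2q̂₂}_x(Q_ρ)} · ‖v₊ ζ‖²_{L^{q₁}_t L^{q₂}_x(Q_ρ)}. -/

import Mathlib

open MeasureTheory Set
open scoped ENNReal NNReal

noncomputable section

abbrev Rd (d : ℕ) := EuclideanSpace ℝ (Fin d)

/-- The open ball `K_ρ ⊆ ℝ^d` centered at the origin. -/
def Kball (d : ℕ) (ρ : ℝ) : Set (Rd d) := Metric.ball 0 ρ

/-- The unit parabolic cylinder `Q₁ = K₁ × (−1,0]`. -/
def Q1S (d : ℕ) : Set (Rd d × ℝ) := (Kball d 1) ×ˢ Set.Ioc (-1 : ℝ) 0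

/-- Spatial partial derivative in direction `i`. -/
def pd (d : ℕ) (f : Rd d → ℝ) (i : Fin d) (x : Rd d) : ℝ :=
  fderiv ℝ f x (EuclideanSpace.single i 1)

/-- Laplacian of a scalar function on `ℝ^d`. -/
def lap (d : ℕ) (f : Rd d → ℝ) (x : Rd d) : ℝ :=
  ∑ i, pd d (fun y => pd d f i y) i x

/-- Divergence of a vector field on `ℝ^d`. -/
def divg (d : ℕ) (F : Rd d → Rd d) (x : Rd d) : ℝ :=
  ∑ i, pd d (fun y => F y i) i x

/-- Mixed norm `L^p_t L^q_x` on `A × I`. -/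
def mixedNorm {d : ℕ} {E : Type*} [NormedAddCommGroup E]
    (p q : ℝ≥0∞) (f : Rd d → ℝ → E) (A : Set (Rd d)) (I : Set ℝ) : ℝ≥0∞ :=
  eLpNorm (fun t => (eLpNorm (fun x => f x t) q (volume.restrict A)).toReal)
    p (volume.restrict I)

/-- `B` is a `C¹` vector field on `Q₁`. -/
def IsC1VF (d : ℕ) (B : Rd d → ℝ → Rd d) : Prop :=
  ContDiffOn ℝ 1 (fun p : Rd d × ℝ => B p.1 p.2) (Q1S d)

/-- A positive classical solution of `∂ₜ u = Δ(u^m) + ∇·(B u)` on `A × I`. -/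
def IsClassicalSolU (d : ℕ) (m : ℝ) (B : Rd d → ℝ → Rd d)
    (u : Rd d → ℝ → ℝ) (A : Set (Rd d)) (I : Set ℝ) : Prop :=
  (∀ x ∈ A, ∀ t ∈ I, 0 < u x t) ∧
  ContinuousOn (fun p : Rd d × ℝ => u p.1 p.2) (closure (A ×ˢ I)) ∧
  (∀ t ∈ I, ContDiffOn ℝ 2 (fun x => u x t) A) ∧
  (∀ x ∈ A, ∀ t ∈ I, DifferentiableAt ℝ (fun s => u x s) t) ∧
  (∀ x ∈ A, ∀ t ∈ I,
    deriv (fun s => u x s) t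
      = lap d (fun y => u y t ^ m) x + divg d (fun y => u y t • B y t) x)

/-- A positive classical solution of `∂ₜ(v^{1/m}) = Δv + ∇·(B v^{1/m})` on `A × I`. -/
def IsClassicalSolV (d : ℕ) (m : ℝ) (B : Rd d → ℝ → Rd d)
    (v : Rd d → ℝ → ℝ) (A : Set (Rd d)) (I : Set ℝ) : Prop :=
  (∀ x ∈ A, ∀ t ∈ I, 0 < v x t) ∧
  ContinuousOn (fun p : Rd d × ℝ => v p.1 p.2) (closure (A ×ˢ I)) ∧
  (∀ t ∈ I, ContDiffOn ℝ 2 (fun x => v x t) A) ∧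
  (∀ x ∈ A, ∀ t ∈ I, DifferentiableAt ℝ (fun s => v x s ^ (1/m)) t) ∧
  (∀ x ∈ A, ∀ t ∈ I,
    deriv (fun s => v x s ^ (1/m)) t
      = lap d (fun y => v y t) x + divg d (fun y => (v y t ^ (1/m)) • B y t) x)

/-- Supremum of `v` over a space-time set. -/
def supOn (d : ℕ) (v : Rd d → ℝ → ℝ) (S : Set (Rd d × ℝ)) : ℝ :=
  sSup ((fun p : Rd d × ℝ => v p.1 p.2) '' S)

/-- Infimum of `v` over a space-time set. -/
def infOn (d : ℕ) (v : Rd d → ℝ → ℝ) (S : Set (Rd d × ℝ)) : ℝ :=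
  sInf ((fun p : Rd d × ℝ => v p.1 p.2) '' S)

/-- Oscillation of `v` over a space-time set. -/
def oscOn (d : ℕ) (v : Rd d → ℝ → ℝ) (S : Set (Rd d × ℝ)) : ℝ :=
  supOn d v S - infOn d v S

/-- The time interval of the intrinsic cylinder `Q_{k,ρ}(θ)`. -/
def ITime (m k ρ θ : ℝ) : Set ℝ := Set.Ioc (-(θ * k ^ (-((m - 1) / m)) * ρ ^ 2)) 0

/-- The intrinsic cylinder `Q_{k,ρ}(θ) = K_ρ × (−θ k^{−β} ρ², 0]`. -/
def QIntr (d : ℕ) (m k ρ θ : ℝ) : Set (Rd d × ℝ) := Kball d ρ ×ˢ ITime m k ρ θ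

/-- The exponent `q = 2 q̂ (1+κ)/(q̂ − 1)` (with value `2(1+κ)` when `q̂ = ∞`). -/
def qdual (qh : ℝ≥0∞) (κ : ℝ) : ℝ :=
  if qh = ∞ then 2 * (1 + κ) else 2 * qh.toReal * (1 + κ) / (qh.toReal - 1)


/-- `B` is divergence-free on `Q₁`. -/
def DivFree (d : ℕ) (B : Rd d → ℝ → Rd d) : Prop :=
  ∀ t ∈ Set.Ioc (-1 : ℝ) 0, ∀ x ∈ Kball d 1, divg d (fun y => B y t) x = 0

section Aux
open Filter Topology

lemma eb_clm_apply {d : ℕ} (L : Rd d →L[ℝ] ℝ) (b : Rd d) :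
    L b = ∑ i, b i * L (EuclideanSpace.single i 1) := by
  have h := (EuclideanSpace.basisFun (Fin d) ℝ).sum_repr b
  conv_lhs => rw [← h]
  simp [map_sum]

lemma eb_norm_sq {d : ℕ} (L : Rd d →L[ℝ] ℝ) :
    ‖L‖ ^ 2 = ∑ i, (L (EuclideanSpace.single i 1)) ^ 2 := by
  have h1 : ‖L‖ = ‖(InnerProductSpace.toDual ℝ (Rd d)).symm L‖ := by simp
  rw [h1, EuclideanSpace.norm_sq_eq]
  refine Finset.sum_congr rfl fun i _ => ?_
  have : (((InnerProductSpace.toDual ℝ (Rd d)).symm L) i : ℝ) = L (EuclideanSpace.single i 1) := by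
    rw [← InnerProductSpace.toDual_symm_apply (𝕜 := ℝ) (y := L)]
    rw [real_inner_comm, EuclideanSpace.inner_single_left]; simp
  rw [this]; simp

lemma eb_cs {d : ℕ} (L M : Rd d →L[ℝ] ℝ) :
    |∑ i, L (EuclideanSpace.single i 1) * M (EuclideanSpace.single i 1)| ≤ ‖L‖ * ‖M‖ := by
  have h := Finset.sum_mul_sq_le_sq_mul_sq Finset.univ
    (fun i => L (EuclideanSpace.single i (1:ℝ))) (fun i => M (EuclideanSpace.single i (1:ℝ)))
  rw [← eb_norm_sq, ← eb_norm_sq, ← mul_pow] at h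
  exact abs_le_of_sq_le_sq h (by positivity)

lemma eb_pd_contDiffAt {d : ℕ} {f : Rd d → ℝ} {x : Rd d} (hf : ContDiffAt ℝ 2 f x) (i : Fin d) :
    ContDiffAt ℝ 1 (fun y => pd d f i y) x := by
  unfold pd
  exact (hf.fderiv_right (m := 1) (by norm_num)).clm_apply contDiffAt_const

lemma eb_single_ne {d : ℕ} (i : Fin d) : (EuclideanSpace.single i (1:ℝ) : Rd d) ≠ 0 := by
  intro h
  have := congrArg (fun z : Rd d => z i) h
  simp at this

/-- one-dimensional second derivative test, necessary condition -/
lemma eb_second {g : ℝ → ℝ} (hc : ContinuousAt g 0) (hm : IsLocalMax g 0) :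
    deriv (deriv g) 0 ≤ 0 := by
  by_contra hcon
  push Not at hcon
  have hmin := isLocalMin_of_deriv_deriv_pos hcon hm.deriv_eq_zero hc
  have heq : g =ᶠ[𝓝 0] fun _ => g 0 := by
    filter_upwards [hmin, hm] with y h1 h2 using le_antisymm h2 h1
  have h1 : deriv g =ᶠ[𝓝 0] fun _ => 0 := by
    have := heq.deriv
    simpa using this
  have h2 := h1.deriv_eq
  simp at h2
  linarith

lemma eb_lap_nonpos {d : ℕ} {f : Rd d → ℝ} {x : Rd d} (hf : ContDiffAt ℝ 2 f x)
    (hm : IsLocalMax f x) : lap d f x ≤ 0 := by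
  unfold lap
  refine Finset.sum_nonpos fun i _ => ?_
  set e : Rd d := EuclideanSpace.single i 1 with he
  have hline : Continuous fun s : ℝ => x + s • e := by fun_prop
  have hline0 : Tendsto (fun s : ℝ => x + s • e) (𝓝 0) (𝓝 x) := by
    have := hline.tendsto 0
    simpa using this
  have hd : ∀ s : ℝ, HasDerivAt (fun s : ℝ => x + s • e) e s := by
    intro s
    have := ((hasDerivAt_id s).smul_const e).const_add x
    simpa using this
  have hev : ∀ᶠ y in 𝓝 x, DifferentiableAt ℝ f y := by
    have := hf.eventually (by simp)
    filter_upwards [this] with y hy using hy.differentiableAt (by norm_num)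
  have h1 : deriv (fun s : ℝ => f (x + s • e)) =ᶠ[𝓝 0] fun s => pd d f i (x + s • e) := by
    filter_upwards [hline0.eventually hev] with s hs
    exact (hs.hasFDerivAt.comp_hasDerivAt s (hd s)).deriv
  have h2 : deriv (deriv (fun s : ℝ => f (x + s • e))) 0 = pd d (fun y => pd d f i y) i x := by
    rw [h1.deriv_eq]
    have hp : DifferentiableAt ℝ (fun y => pd d f i y) (x + (0:ℝ) • e) := by
      simpa using (eb_pd_contDiffAt hf i).differentiableAt (by norm_num)
    have := (hp.hasFDerivAt.comp_hasDerivAt (0:ℝ) (hd 0)).deriv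
    simp only [Function.comp_def] at this
    rw [this]
    simp [pd, he]
  rw [← h2]
  apply eb_second
  · have : ContinuousAt f (x + (0:ℝ) • e) := by simpa using hf.continuousAt
    exact ContinuousAt.comp (f := fun s : ℝ => x + s • e) (g := f) this hline.continuousAt
  · have := hline0.eventually hm
    filter_upwards [this] with s hs
    simpa using hs

lemma eb_pd_add {d : ℕ} {f g : Rd d → ℝ} {x : Rd d} (hf : DifferentiableAt ℝ f x)
    (hg : DifferentiableAt ℝ g x) (i : Fin d) :
    pd d (fun y => f y + g y) i x = pd d f i x + pd d g i x := by
  unfold pd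
  rw [show (fun y => f y + g y) = f + g from rfl, fderiv_add hf hg]; rfl

lemma eb_lap_add {d : ℕ} {f g : Rd d → ℝ} {x : Rd d} (hf : ContDiffAt ℝ 2 f x)
    (hg : ContDiffAt ℝ 2 g x) : lap d (fun y => f y + g y) x = lap d f x + lap d g x := by
  unfold lap
  rw [← Finset.sum_add_distrib]
  refine Finset.sum_congr rfl fun i _ => ?_
  have h : (fun y => pd d (fun y => f y + g y) i y) =ᶠ[𝓝 x] fun y => pd d f i y + pd d g i y := by
    filter_upwards [hf.eventually (by simp), hg.eventually (by simp)] with y h1 h2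
    exact eb_pd_add (h1.differentiableAt (by norm_num)) (h2.differentiableAt (by norm_num)) i
  have h' : pd d (fun y => pd d (fun y => f y + g y) i y) i x
      = pd d (fun y => pd d f i y + pd d g i y) i x := by
    unfold pd at h ⊢
    rw [Filter.EventuallyEq.fderiv_eq h]
  rw [h']
  exact eb_pd_add ((eb_pd_contDiffAt hf i).differentiableAt (by norm_num))
    ((eb_pd_contDiffAt hg i).differentiableAt (by norm_num)) i

lemma eb_pd_neg {d : ℕ} {f : Rd d → ℝ} {x : Rd d} (i : Fin d) :
    pd d (fun y => - f y) i x = - pd d f i x := by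
  unfold pd
  rw [fderiv_fun_neg]; rfl

lemma eb_lap_neg {d : ℕ} {f : Rd d → ℝ} {x : Rd d} :
    lap d (fun y => - f y) x = - lap d f x := by
  unfold lap
  simp only [eb_pd_neg, Finset.sum_neg_distrib]

lemma eb_hasFDerivAt_nsq {d : ℕ} (x0 x : Rd d) :
    HasFDerivAt (fun y : Rd d => ‖y - x0‖ ^ 2) ((2:ℝ) • innerSL ℝ (x - x0)) x := by
  have h := (hasFDerivAt_id (𝕜 := ℝ) x).sub_const x0
  have := h.norm_sq
  exact this.congr_fderiv (by ext y; simp [two_mul])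

lemma eb_pd_nsq {d : ℕ} (x0 x : Rd d) (i : Fin d) :
    pd d (fun y : Rd d => ‖y - x0‖ ^ 2) i x = 2 * (x i - x0 i) := by
  unfold pd
  rw [(eb_hasFDerivAt_nsq x0 x).fderiv]
  simp [EuclideanSpace.inner_single_right]

lemma eb_lap_nsq {d : ℕ} (x0 x : Rd d) :
    lap d (fun y : Rd d => ‖y - x0‖ ^ 2) x = 2 * d := by
  unfold lap
  simp only [eb_pd_nsq]
  have : ∀ i : Fin d, pd d (fun y : Rd d => 2 * (y i - x0 i)) i x = 2 := by
    intro i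
    unfold pd
    have h : HasFDerivAt (fun y : Rd d => 2 * (y i - x0 i))
        ((2:ℝ) • (EuclideanSpace.proj i : Rd d →L[ℝ] ℝ)) x :=
      (((EuclideanSpace.proj i : Rd d →L[ℝ] ℝ).hasFDerivAt).sub_const (x0 i)).const_mul 2
    rw [h.fderiv]; simp
  simp [this, mul_comm]

lemma eb_lap_continuous {d : ℕ} {f : Rd d → ℝ} (hf : ContDiff ℝ 2 f) :
    Continuous (fun x => lap d f x) := by
  unfold lap
  refine continuous_finsetSum _ fun i _ => ?_
  have h1 : ContDiff ℝ 1 (fun y => pd d f i y) :=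
    contDiff_iff_contDiffAt.2 fun x => eb_pd_contDiffAt hf.contDiffAt i
  unfold pd at h1 ⊢
  exact (h1.continuous_fderiv (by norm_num)).clm_apply continuous_const

/-- extension of a function defined on a ball by multiplication with a bump -/
lemma eb_contDiff_mul {d : ℕ} {n : ℕ} {χ f : Rd d → ℝ} {U : Set (Rd d)} (hU : IsOpen U)
    (hχ : ContDiff ℝ n χ) (hs : tsupport χ ⊆ U) (hf : ContDiffOn ℝ n f U) :
    ContDiff ℝ n (fun x => χ x * f x) := by
  rw [contDiff_iff_contDiffAt]
  intro x
  by_cases hx : x ∈ tsupport χ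
  · exact hχ.contDiffAt.mul (hf.contDiffAt (hU.mem_nhds (hs hx)))
  · have : (fun x => χ x * f x) =ᶠ[𝓝 x] fun _ => 0 := by
      have h := notMem_tsupport_iff_eventuallyEq.1 hx
      filter_upwards [h] with y hy
      simp [hy]
    exact contDiffAt_const.congr_of_eventuallyEq this

/-- localisation: a `C^n` compactly supported function coinciding with `f` on a smaller ball. -/
lemma eb_localize {d : ℕ} {n : ℕ} {f : Rd d → ℝ} {ρ r : ℝ} (hr : 0 < r) (hrρ : r < ρ)
    (hf : ContDiffOn ℝ n f (Metric.ball 0 ρ)) :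
    ∃ g : Rd d → ℝ, ContDiff ℝ n g ∧ HasCompactSupport g ∧ ∀ x ∈ Metric.closedBall (0 : Rd d) r,
      g x = f x := by
  let χ : ContDiffBump (0 : Rd d) := ⟨r, (r + ρ) / 2, hr, by linarith⟩
  refine ⟨fun x => χ x * f x, eb_contDiff_mul Metric.isOpen_ball χ.contDiff ?_ hf, ?_, ?_⟩
  · rw [χ.tsupport_eq]
    exact Metric.closedBall_subset_ball (by show (r + ρ) / 2 < ρ; linarith)
  · exact χ.hasCompactSupport.mul_right
  · intro x hx
    have := χ.one_of_mem_closedBall hx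
    simp [this]

lemma eb_barrier {d : ℕ} {u a : Rd d → ℝ → ℝ} {b : Rd d → ℝ → Rd d} {ρ ρ' s0 s1 A0 B0 : ℝ}
    (hρ' : 0 < ρ') (hρρ : ρ' < ρ) (hs : s0 < s1)
    (hcont : ContinuousOn (fun p : Rd d × ℝ => u p.1 p.2) (Metric.closedBall 0 ρ ×ˢ Icc s0 s1))
    (hC2 : ∀ t ∈ Icc s0 s1, ContDiffOn ℝ 2 (fun x => u x t) (Metric.ball 0 ρ))
    (hder : ∀ x ∈ Metric.ball (0 : Rd d) ρ, ∀ t ∈ Ioc s0 s1,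
      HasDerivAt (fun s => u x s) (a x t * lap d (fun y => u y t) x
        + fderiv ℝ (fun y => u y t) x (b x t)) t)
    (ha0 : ∀ x ∈ Metric.ball (0 : Rd d) ρ, ∀ t ∈ Icc s0 s1, 0 ≤ a x t)
    (ha1 : ∀ x ∈ Metric.ball (0 : Rd d) ρ, ∀ t ∈ Icc s0 s1, a x t ≤ A0)
    (hb : ∀ x ∈ Metric.ball (0 : Rd d) ρ, ∀ t ∈ Icc s0 s1, ‖b x t‖ ≤ B0) :
    ∃ N δ : ℝ, 0 ≤ N ∧ 0 < δ ∧ s0 + δ ≤ s1 ∧ ∀ x ∈ Metric.closedBall (0 : Rd d) ρ',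
      ∀ t ∈ Icc s0 (s0 + δ), u x t ≤ u x s0 + N * (t - s0) := by
  have h00 : (0 : Rd d) ∈ Metric.ball (0 : Rd d) ρ := by simp; linarith
  have hs0 : s0 ∈ Icc s0 s1 := ⟨le_rfl, hs.le⟩
  have hA0 : 0 ≤ A0 := (ha0 0 h00 s0 hs0).trans (ha1 0 h00 s0 hs0)
  have hB0 : 0 ≤ B0 := (norm_nonneg _).trans (hb 0 h00 s0 hs0)
  set r := (ρ - ρ') / 3 with hr
  have hrpos : 0 < r := by rw [hr]; linarith
  set ρm := ρ' + 2 * r with hρm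
  have hρm1 : ρm < ρ := by rw [hρm, hr]; linarith
  obtain ⟨g, hg, hgc, hgeq⟩ := eb_localize (n := 2) (f := fun x => u x s0) (r := ρm)
    (by rw [hρm]; linarith) hρm1 (hC2 s0 hs0)
  obtain ⟨M1, hM1⟩ := (hgc.fderiv ℝ).exists_bound_of_continuous (hg.continuous_fderiv (by norm_num))
  have hlapc : HasCompactSupport (fun x => lap d g x) := by
    refine HasCompactSupport.of_support_subset_isCompact (K := tsupport g) hgc ?_
    intro x hx
    by_contra hxn
    apply hx
    have h := notMem_tsupport_iff_eventuallyEq.1 hxn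
    have h1 : ∀ i, (fun y => pd d g i y) =ᶠ[𝓝 x] fun _ => 0 := by
      intro i
      filter_upwards [h.eventuallyEq_nhds] with y hy
      unfold pd
      rw [hy.fderiv_eq]; simp
    unfold lap
    refine Finset.sum_eq_zero fun i _ => ?_
    unfold pd at h1 ⊢
    rw [(h1 i).fderiv_eq]; simp
  obtain ⟨M2, hM2⟩ := hlapc.exists_bound_of_continuous (eb_lap_continuous hg)
  have hM10 : 0 ≤ M1 := (norm_nonneg _).trans (hM1 0)
  have hM20 : 0 ≤ M2 := (norm_nonneg _).trans (hM2 0)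
  -- uniform continuity in time
  have hK : IsCompact (Metric.closedBall (0 : Rd d) ρ ×ˢ Icc s0 s1) :=
    (isCompact_closedBall _ _).prod isCompact_Icc
  have huc := hK.uniformContinuousOn_of_continuous hcont
  rw [Metric.uniformContinuousOn_iff] at huc
  obtain ⟨δ0, hδ0, huc⟩ := huc (r ^ 2) (by positivity)
  set N := A0 * (M2 + 2 * d) + B0 * (M1 + 2 * r) + 1 with hN
  have hN0 : 0 ≤ N := by positivity
  set δ := min (δ0 / 2) (s1 - s0) with hδ
  have hδpos : 0 < δ := lt_min (by linarith) (by linarith)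
  have hδ1 : δ ≤ δ0 / 2 := min_le_left _ _
  have hδ2 : s0 + δ ≤ s1 := by have := min_le_right (δ0 / 2) (s1 - s0); linarith
  refine ⟨N, δ, hN0, hδpos, hδ2, fun x0 hx0 => ?_⟩
  by_contra hcon
  push Not at hcon
  obtain ⟨τ, hτ, hlt⟩ := hcon
  have hx0n : ‖x0‖ ≤ ρ' := by simpa using hx0
  -- the ball around x0
  have hball : ∀ x ∈ Metric.closedBall x0 r, ‖x‖ < ρm := by
    intro x hx
    have h1 : ‖x - x0‖ ≤ r := by simpa [dist_eq_norm] using hx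
    have h2 : ‖x‖ ≤ ‖x - x0‖ + ‖x0‖ := by simpa using norm_add_le (x - x0) x0
    rw [hρm]; linarith
  have hsub : ∀ x ∈ Metric.closedBall x0 r, x ∈ Metric.ball (0 : Rd d) ρ := by
    intro x hx
    have := hball x hx
    simp; linarith
  set F : Rd d × ℝ → ℝ := fun p => u p.1 p.2 + (-(g p.1 + ‖p.1 - x0‖ ^ 2 + N * (p.2 - s0))) with hF
  have hcyl : IsCompact (Metric.closedBall x0 r ×ˢ Icc s0 (s0 + δ)) :=
    (isCompact_closedBall _ _).prod isCompact_Icc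
  have hFc : ContinuousOn F (Metric.closedBall x0 r ×ˢ Icc s0 (s0 + δ)) := by
    apply ContinuousOn.add
    · refine hcont.mono (prod_mono (fun x hx => Metric.ball_subset_closedBall (hsub x hx)) ?_)
      exact Icc_subset_Icc le_rfl hδ2
    · have := hg.continuous
      fun_prop
  obtain ⟨⟨x1, t1⟩, ⟨hx1, ht1⟩, hmax⟩ := hcyl.exists_isMaxOn
    ⟨(x0, s0), ⟨Metric.mem_closedBall_self hrpos.le, ⟨le_rfl, by linarith⟩⟩⟩ hFc
  simp only at hx1 ht1
  have hgx0 : g x0 = u x0 s0 := hgeq x0 (by simp; rw [hρm]; linarith)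
  have hFpos : 0 < F (x1, t1) := by
    have h1 : F (x0, τ) ≤ F (x1, t1) := hmax ⟨Metric.mem_closedBall_self hrpos.le, hτ⟩
    have h2 : 0 < F (x0, τ) := by simp only [hF]; rw [hgx0]; simp; linarith
    linarith
  have hgx1 : g x1 = u x1 s0 := hgeq x1 (by simp; exact (hball x1 hx1).le)
  have ht1' : t1 ∈ Icc s0 s1 := ⟨ht1.1, ht1.2.trans hδ2⟩
  have hosc : u x1 t1 < u x1 s0 + r ^ 2 := by
    have := huc (x1, t1) ⟨Metric.ball_subset_closedBall (hsub x1 hx1), ht1'⟩ (x1, s0)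
      ⟨Metric.ball_subset_closedBall (hsub x1 hx1), hs0⟩ (by
        rw [Prod.dist_eq]
        simp only [dist_self, Real.dist_eq]
        rw [max_eq_right (abs_nonneg _), abs_of_nonneg (by linarith [ht1.1])]
        linarith [ht1.2])
    rw [Real.dist_eq] at this
    linarith [(abs_lt.1 this).2]
  have hNt : 0 ≤ N * (t1 - s0) := mul_nonneg hN0 (by linarith [ht1.1])
  have hx1lt : ‖x1 - x0‖ < r := by
    by_contra hge
    push Not at hge
    have : r ^ 2 ≤ ‖x1 - x0‖ ^ 2 := by gcongr
    simp only [hF] at hFpos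
    rw [hgx1] at hFpos
    linarith
  have ht1lt : s0 < t1 := by
    rcases ht1.1.lt_or_eq with h | h
    · exact h
    · exfalso
      simp only [hF] at hFpos
      rw [hgx1, ← h] at hFpos
      have : 0 ≤ ‖x1 - x0‖ ^ 2 := by positivity
      linarith
  have hx1b := hsub x1 hx1
  -- spatial conditions
  set f1 : Rd d → ℝ := fun x => u x t1 with hf1
  have hf1C : ContDiffAt ℝ 2 f1 x1 := (hC2 t1 ht1').contDiffAt (Metric.isOpen_ball.mem_nhds hx1b)
  have hnsqC : ContDiff ℝ 2 (fun y : Rd d => ‖y - x0‖ ^ 2) :=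
    (contDiff_id.sub contDiff_const).norm_sq ℝ
  have hlm : IsLocalMax (fun x => f1 x + (-(g x + ‖x - x0‖ ^ 2))) x1 := by
    have hnb : Metric.closedBall x0 r ∈ 𝓝 x1 := by
      refine mem_of_superset (Metric.isOpen_ball.mem_nhds ?_) Metric.ball_subset_closedBall
      simpa [dist_eq_norm] using hx1lt
    filter_upwards [hnb] with x hx
    have : F (x, t1) ≤ F (x1, t1) := hmax ⟨hx, ht1⟩
    simp only [hF] at this
    simp only [hf1]
    linarith
  have hgn : ContDiffAt ℝ 2 (fun x => g x + ‖x - x0‖ ^ 2) x1 := (hg.add hnsqC).contDiffAt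
  have hlap := eb_lap_nonpos (hf1C.add hgn.neg) hlm
  have hgrad := hlm.fderiv_eq_zero
  have hgd : HasFDerivAt (fun x => g x + ‖x - x0‖ ^ 2)
      (fderiv ℝ g x1 + (2:ℝ) • innerSL ℝ (x1 - x0)) x1 :=
    ((hg.differentiable (by norm_num)) x1).hasFDerivAt.add (eb_hasFDerivAt_nsq x0 x1)
  have hfd := (hf1C.differentiableAt (by norm_num)).hasFDerivAt
  have hgrad2 : fderiv ℝ f1 x1 = fderiv ℝ g x1 + (2:ℝ) • innerSL ℝ (x1 - x0) := by
    have := (hfd.add hgd.neg).fderiv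
    rw [show (f1 + -fun x => g x + ‖x - x0‖ ^ 2) = (fun x => f1 x + (-(g x + ‖x - x0‖ ^ 2)))
      from rfl, hgrad] at this
    exact (eq_of_sub_eq_zero (by rw [sub_eq_add_neg]; exact this.symm))
  have hlap2 : lap d f1 x1 ≤ M2 + 2 * d := by
    rw [eb_lap_add hf1C hgn.neg, eb_lap_neg, eb_lap_add hg.contDiffAt hnsqC.contDiffAt,
      eb_lap_nsq] at hlap
    have := (abs_le.1 (hM2 x1)).2
    linarith
  have hgradn : ‖fderiv ℝ f1 x1‖ ≤ M1 + 2 * r := by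
    rw [hgrad2]
    refine (norm_add_le _ _).trans (add_le_add (hM1 x1) ?_)
    rw [norm_smul, innerSL_apply_norm]
    simp
    linarith
  -- time condition
  have hdt := hder x1 hx1b t1 ⟨ht1lt, ht1'.2⟩
  have hlin : HasDerivAt (fun s => u x1 s - N * (s - s0)) (a x1 t1 * lap d f1 x1
        + fderiv ℝ f1 x1 (b x1 t1) - N) t1 := by
    have h2 : HasDerivAt (fun s => N * (s - s0)) N t1 := by
      simpa using ((hasDerivAt_id t1).sub_const s0).const_mul N
    exact hdt.sub h2
  have hge : 0 ≤ a x1 t1 * lap d f1 x1 + fderiv ℝ f1 x1 (b x1 t1) - N := by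
    have h1 := (hasDerivAt_iff_tendsto_slope.1 hlin).mono_left
      (nhdsWithin_mono t1 (s := Iio t1) (fun s (hs : s < t1) => ne_of_lt hs))
    refine ge_of_tendsto h1 ?_
    have hnear : ∀ᶠ s in 𝓝[<] t1, s0 < s :=
      nhdsWithin_le_nhds (lt_mem_nhds ht1lt)
    filter_upwards [hnear, self_mem_nhdsWithin] with s hs1 (hs2 : s < t1)
    have hle : F (x1, s) ≤ F (x1, t1) := hmax ⟨hx1, ⟨hs1.le, by linarith [ht1.2]⟩⟩
    simp only [hF] at hle
    rw [slope_def_field]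
    apply div_nonneg_of_nonpos <;> linarith
  have e1 : a x1 t1 * lap d f1 x1 ≤ A0 * (M2 + 2 * d) := by
    calc a x1 t1 * lap d f1 x1 ≤ a x1 t1 * (M2 + 2 * d) :=
          mul_le_mul_of_nonneg_left hlap2 (ha0 x1 hx1b t1 ht1')
      _ ≤ _ := mul_le_mul_of_nonneg_right (ha1 x1 hx1b t1 ht1') (by positivity)
  have e2 : fderiv ℝ f1 x1 (b x1 t1) ≤ B0 * (M1 + 2 * r) := by
    calc _ ≤ ‖fderiv ℝ f1 x1 (b x1 t1)‖ := Real.le_norm_self _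
      _ ≤ ‖fderiv ℝ f1 x1‖ * ‖b x1 t1‖ := ContinuousLinearMap.le_opNorm _ _
      _ ≤ (M1 + 2 * r) * B0 := mul_le_mul hgradn (hb x1 hx1b t1 ht1') (norm_nonneg _) (by positivity)
      _ = _ := mul_comm _ _
  linarith

lemma eb_ibp0 {d : ℕ} {F : Rd d → ℝ} {C : ℝ≥0} (hF : LipschitzWith C F) (hc : HasCompactSupport F)
    (e : Rd d) : ∫ x, lineDeriv ℝ F x e = 0 := by
  have h := LipschitzWith.integral_lineDeriv_mul_eq (μ := (volume : Measure (Rd d)))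
    (f := fun _ => (1:ℝ)) (C := 0) (LipschitzWith.const 1) hF hc (-e)
  have hz : ∀ x : Rd d, lineDeriv ℝ (fun _ : Rd d => (1:ℝ)) x (-e) = 0 := by
    intro x; simp [lineDeriv]
  simpa [hz] using h.symm

lemma eb_pd_compact {d : ℕ} {f : Rd d → ℝ} (hc : HasCompactSupport f) (i : Fin d) :
    HasCompactSupport (fun x => pd d f i x) := by
  have h := hc.fderiv ℝ
  exact h.comp_left (g := fun L : Rd d →L[ℝ] ℝ => L (EuclideanSpace.single i 1)) (by simp)

lemma eb_pd_continuous {d : ℕ} {f : Rd d → ℝ} (hf : ContDiff ℝ 1 f) (i : Fin d) :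
    Continuous (fun x => pd d f i x) :=
  (hf.continuous_fderiv (by norm_num)).clm_apply continuous_const

lemma eb_ibpB {d : ℕ} {f : Rd d → ℝ} (hf : ContDiff ℝ 1 f) (hc : HasCompactSupport f) (i : Fin d) :
    Integrable (fun x => pd d f i x) ∧ ∫ x, pd d f i x = 0 := by
  refine ⟨(eb_pd_continuous hf i).integrable_of_hasCompactSupport (eb_pd_compact hc i), ?_⟩
  obtain ⟨C, hC⟩ := hf.lipschitzWith_of_hasCompactSupport hc (by norm_num)
  rw [← eb_ibp0 hC hc (EuclideanSpace.single i 1)]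
  congr 1
  ext x
  exact ((hf.differentiable (by norm_num)) x).lineDeriv_eq_fderiv.symm

lemma eb_lip_mul {d : ℕ} {f g : Rd d → ℝ} {C D : ℝ≥0} (hf : LipschitzWith C f)
    (hg : LipschitzWith D g) {Mf Mg : ℝ} (hMf : ∀ x, |f x| ≤ Mf) (hMg : ∀ x, |g x| ≤ Mg) :
    ∃ K, LipschitzWith K (fun x => f x * g x) := by
  have hMf0 : 0 ≤ Mf := (abs_nonneg _).trans (hMf 0)
  have hMg0 : 0 ≤ Mg := (abs_nonneg _).trans (hMg 0)
  refine ⟨C * Mg.toNNReal + Mf.toNNReal * D, LipschitzWith.of_dist_le_mul fun x y => ?_⟩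
  have h1 := hf.dist_le_mul x y
  have h2 := hg.dist_le_mul x y
  simp only [NNReal.coe_add, NNReal.coe_mul, Real.coe_toNNReal _ hMf0, Real.coe_toNNReal _ hMg0]
  rw [Real.dist_eq] at h1 h2 ⊢
  calc |f x * g x - f y * g y| = |(f x - f y) * g x + f y * (g x - g y)| := by ring_nf
    _ ≤ |(f x - f y) * g x| + |f y * (g x - g y)| := abs_add_le _ _
    _ = |f x - f y| * |g x| + |f y| * |g x - g y| := by rw [abs_mul, abs_mul]
    _ ≤ (C * dist x y) * Mg + Mf * (D * dist x y) := by
        gcongr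
        · exact hMg x
        · exact hMf y
    _ = _ := by ring

lemma eb_pd_mul {d : ℕ} {f g : Rd d → ℝ} {x : Rd d} (hf : DifferentiableAt ℝ f x)
    (hg : DifferentiableAt ℝ g x) (i : Fin d) :
    pd d (fun y => f y * g y) i x = f x * pd d g i x + g x * pd d f i x := by
  unfold pd
  rw [fderiv_fun_mul hf hg]; simp

/-- Integrand of the integration by parts identity for the truncation. -/
def ebJ (d : ℕ) (u η : Rd d → ℝ) (l : ℝ) (i : Fin d) (x : Rd d) : ℝ :=
  ({y | l < u y}.indicator (fun y => pd d u i y ^ 2 * η y) x)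
    + max (u x - l) 0 * (pd d (fun y => pd d u i y) i x * η x + pd d u i x * pd d η i x)

lemma eb_ibpA {d : ℕ} {u η : Rd d → ℝ} (hu : ContDiff ℝ 2 u) (huc : HasCompactSupport u)
    (hη : ContDiff ℝ 1 η) (hηc : HasCompactSupport η) (l : ℝ) (i : Fin d) :
    Integrable (ebJ d u η l i) ∧ ∫ x, ebJ d u η l i x = 0 := by
  have hpu : ContDiff ℝ 1 (fun y => pd d u i y) :=
    contDiff_iff_contDiffAt.2 fun x => eb_pd_contDiffAt hu.contDiffAt i
  have hu1 : ContDiff ℝ 1 u := hu.of_le (by norm_num)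
  constructor
  · unfold ebJ
    apply Integrable.add
    · apply Integrable.indicator
      · apply Continuous.integrable_of_hasCompactSupport
        · exact (hpu.continuous.pow 2).mul hη.continuous
        · exact hηc.mul_left
      · exact (isOpen_lt continuous_const hu.continuous).measurableSet
    · apply Continuous.integrable_of_hasCompactSupport
      · have h1 := eb_pd_continuous hpu i
        have h2 := eb_pd_continuous hη i
        have h3 := hu.continuous
        have h4 := hη.continuous
        have h5 := hpu.continuous
        fun_prop
      · exact ((hηc.mul_left).add ((eb_pd_compact hηc i).mul_left)).mul_left
  · set f : Rd d → ℝ := fun x => max (u x - l) 0 with hf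
    set g : Rd d → ℝ := fun x => η x * pd d u i x with hg
    have hgC : ContDiff ℝ 1 g := hη.mul hpu
    have hgc : HasCompactSupport g := hηc.mul_right
    obtain ⟨Cu, hCu⟩ := hu1.lipschitzWith_of_hasCompactSupport huc (by norm_num)
    obtain ⟨Cg, hCg⟩ := hgC.lipschitzWith_of_hasCompactSupport hgc (by norm_num)
    have hfl : LipschitzWith Cu f := by
      have h1 : LipschitzWith Cu (fun x => u x - l) := by
        refine LipschitzWith.of_dist_le_mul fun x y => ?_
        have := hCu.dist_le_mul x y
        simpa using this
      exact h1.max_const 0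
    obtain ⟨Mu, hMu⟩ := huc.exists_bound_of_continuous hu.continuous
    obtain ⟨Mg, hMg⟩ := hgc.exists_bound_of_continuous hgC.continuous
    obtain ⟨K, hK⟩ := eb_lip_mul hfl hCg (Mf := Mu + |l|) (Mg := Mg) (by
      intro x
      simp only [hf]
      rw [abs_of_nonneg (le_max_right _ _)]
      have := hMu x
      rw [Real.norm_eq_abs] at this
      apply max_le
      · linarith [le_abs_self (u x), neg_abs_le l]
      · linarith [abs_nonneg (u x), abs_nonneg l]) hMg
    have hz := eb_ibp0 hK (hgc.mul_left) (EuclideanSpace.single i 1)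
    rw [← hz]
    apply integral_congr_ae
    filter_upwards [hfl.ae_differentiableAt (μ := volume)] with x hx
    have hgd : DifferentiableAt ℝ g x := (hgC.differentiable (by norm_num)) x
    have h1 : lineDeriv ℝ (fun x => f x * g x) x (EuclideanSpace.single i 1)
        = pd d (fun y => f y * g y) i x := by
      exact (hx.mul hgd).lineDeriv_eq_fderiv
    rw [h1, eb_pd_mul hx hgd]
    have hηd : DifferentiableAt ℝ η x := (hη.differentiable (by norm_num)) x
    have hpud : DifferentiableAt ℝ (fun y => pd d u i y) x := (hpu.differentiable (by norm_num)) x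
    have h2 : pd d g i x = η x * pd d (fun y => pd d u i y) i x + pd d u i x * pd d η i x :=
      eb_pd_mul hηd hpud i
    rw [h2]
    unfold ebJ
    by_cases hlu : l < u x
    · have h3 : pd d f i x = pd d u i x := by
        have : f =ᶠ[𝓝 x] fun y => u y - l := by
          filter_upwards [(isOpen_lt continuous_const hu.continuous).mem_nhds hlu] with y hy
          simp only [hf]
          exact max_eq_left (sub_nonneg.2 (le_of_lt hy))
        unfold pd
        rw [this.fderiv_eq, fderiv_sub_const]
      rw [h3, indicator_of_mem (by exact hlu)]
      simp only [hf, hg]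
      ring
    · have h3 : pd d f i x = 0 := by
        have : IsLocalMin f x := by
          have h0 : f x = 0 := by simp only [hf]; exact max_eq_right (by linarith)
          filter_upwards with y
          rw [h0]; exact le_max_right _ _
        unfold pd
        rw [this.fderiv_eq_zero]; simp
      rw [h3, indicator_of_notMem (by exact hlu)]
      simp only [hf]
      ring

/-- The derivative of the energy density. -/
def ebp (m l s : ℝ) : ℝ := (1 / m) * max (s - l) 0 * (max s l) ^ (-((m - 1) / m))
/-- The energy density. -/
def ebP (m l s : ℝ) : ℝ := ∫ r in l..s, ebp m l r

lemma ebp_continuous {m l : ℝ} (hl : 0 < l) : Continuous (ebp m l) := by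
  unfold ebp
  refine (by fun_prop : Continuous fun s : ℝ => (1 / m) * max (s - l) 0).mul ?_
  refine Continuous.rpow_const (by fun_prop) fun s => Or.inl ?_
  have : l ≤ max s l := le_max_right _ _
  linarith

lemma ebP_hasDerivAt {m l : ℝ} (hl : 0 < l) (s : ℝ) : HasDerivAt (ebP m l) (ebp m l s) s :=
  intervalIntegral.integral_hasDerivAt_right ((ebp_continuous hl).intervalIntegrable _ _)
    (ebp_continuous hl).stronglyMeasurable.stronglyMeasurableAtFilter
    (ebp_continuous hl).continuousAt

lemma ebp_nonneg {m l : ℝ} (hm : 1 ≤ m) (hl : 0 < l) (s : ℝ) : 0 ≤ ebp m l s := by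
  unfold ebp
  have : 0 ≤ max s l := hl.le.trans (le_max_right _ _)
  positivity

lemma ebP_of_le {m l s : ℝ} (hs : s ≤ l) : ebP m l s = 0 := by
  unfold ebP
  rw [intervalIntegral.integral_symm]
  rw [intervalIntegral.integral_zero_ae]
  · simp
  · filter_upwards with r hr
    rw [uIoc_of_le hs] at hr
    unfold ebp
    rw [max_eq_right (by linarith [hr.2])]; simp

lemma eb_int_lin (l s c : ℝ) : ∫ r in l..s, c * (r - l) = c * ((s - l) ^ 2 / 2) := by
  rw [intervalIntegral.integral_const_mul, intervalIntegral.integral_comp_sub_right (fun x => x)]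
  simp

lemma ebP_upper {m l : ℝ} (hm : 1 ≤ m) (hl : 0 < l) (s : ℝ) :
    ebP m l s ≤ (1 / (2 * m)) * l ^ (-((m - 1) / m)) * (max (s - l) 0) ^ 2 := by
  have hm0 : 0 < m := by linarith
  rcases le_or_gt s l with h | h
  · rw [ebP_of_le h]; positivity
  · rw [max_eq_left (by linarith)]
    have h1 : ebP m l s ≤ ∫ r in l..s, ((1 / m) * l ^ (-((m - 1) / m))) * (r - l) := by
      unfold ebP
      apply intervalIntegral.integral_mono_on h.le ((ebp_continuous hl).intervalIntegrable _ _)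
        (Continuous.intervalIntegrable (by fun_prop) _ _)
      intro r hr
      unfold ebp
      rw [max_eq_left (by linarith [hr.1]), max_eq_left hr.1]
      have h2 : r ^ (-((m - 1) / m)) ≤ l ^ (-((m - 1) / m)) :=
        Real.rpow_le_rpow_of_nonpos hl hr.1 (by
          have : 0 ≤ (m - 1) / m := div_nonneg (by linarith) hm0.le
          linarith)
      have h3 : 0 ≤ (1 / m) * (r - l) := mul_nonneg (by positivity) (by linarith [hr.1])
      nlinarith [mul_le_mul_of_nonneg_left h2 h3]
    rw [eb_int_lin] at h1
    refine h1.trans (le_of_eq ?_)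
    field_simp

lemma ebP_lower {m l μ : ℝ} (hm : 1 ≤ m) (hl : 0 < l) {s : ℝ} (hs : s ≤ μ) :
    (1 / (2 * m)) * μ ^ (-((m - 1) / m)) * (max (s - l) 0) ^ 2 ≤ ebP m l s := by
  have hm0 : 0 < m := by linarith
  rcases le_or_gt s l with h | h
  · rw [ebP_of_le h, max_eq_right (by linarith)]; simp
  · rw [max_eq_left (by linarith)]
    have h1 : ∫ r in l..s, ((1 / m) * μ ^ (-((m - 1) / m))) * (r - l) ≤ ebP m l s := by
      unfold ebP
      apply intervalIntegral.integral_mono_on h.le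
        (Continuous.intervalIntegrable (by fun_prop) _ _)
        ((ebp_continuous hl).intervalIntegrable _ _)
      intro r hr
      unfold ebp
      rw [max_eq_left (by linarith [hr.1]), max_eq_left hr.1]
      have h2 : μ ^ (-((m - 1) / m)) ≤ r ^ (-((m - 1) / m)) :=
        Real.rpow_le_rpow_of_nonpos (by linarith [hr.1]) (by linarith [hr.2]) (by
          have : 0 ≤ (m - 1) / m := div_nonneg (by linarith) hm0.le
          linarith)
      have h3 : 0 ≤ (1 / m) * (r - l) := mul_nonneg (by positivity) (by linarith [hr.1])
      nlinarith [mul_le_mul_of_nonneg_left h2 h3]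
    rw [eb_int_lin] at h1
    refine le_trans (le_of_eq ?_) h1
    field_simp

lemma ebP_nonneg {m l : ℝ} (hm : 1 ≤ m) (hl : 0 < l) (s : ℝ) : 0 ≤ ebP m l s := by
  rcases le_or_gt s l with h | h
  · rw [ebP_of_le h]
  · exact intervalIntegral.integral_nonneg h.le fun r _ => ebp_nonneg hm hl r

lemma ebP_contDiff {m l : ℝ} (hl : 0 < l) : ContDiff ℝ 1 (ebP m l) := by
  rw [contDiff_one_iff_deriv]
  refine ⟨fun s => (ebP_hasDerivAt hl s).differentiableAt, ?_⟩
  rw [show deriv (ebP m l) = ebp m l from funext fun s => (ebP_hasDerivAt hl s).deriv]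
  exact ebp_continuous hl

/-- pointwise algebra of the energy estimate -/
lemma eb_alg {m lam a g b y z Z P k τ D1 D2 : ℝ} (hm : 1 ≤ m) (hlam : 0 ≤ lam) (ha : 0 ≤ a)
    (hg : 0 ≤ g) (hb : 0 ≤ b) (hy : 0 ≤ y) (hyk : y ≤ k) (hz : 0 ≤ z) (hzZ : z ≤ Z)
    (hP : 0 ≤ P) (hP1 : P ≤ 1 / (2 * m) * lam * y ^ 2) (hD1 : |D1| ≤ a * g) (hD2 : |D2| ≤ g * b) :
    - (a ^ 2 * z ^ 2) - y * (2 * z * D1) - P * (2 * z * D2) + P * (2 * z * τ)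
      ≤ - (1 / 2) * (a ^ 2 * z ^ 2) + 5 / 2 * k ^ 2 * g ^ 2 + 1 / 2 * lam ^ 2 * (b ^ 2 * (y * Z) ^ 2)
        + lam * k ^ 2 * |Z * τ| := by
  have hP2 : P ≤ 1 / 2 * lam * y ^ 2 := by
    refine hP1.trans ?_
    have : 1 / (2 * m) ≤ 1 / 2 := by
      apply one_div_le_one_div_of_le <;> linarith
    have h2 : 0 ≤ lam * y ^ 2 := by positivity
    nlinarith
  have hyk2 : y ^ 2 ≤ k ^ 2 := by gcongr
  have e1 : - (y * (2 * z * D1)) ≤ 2 * y * z * (a * g) := by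
    have := (abs_le.1 hD1).1
    have h2 : 0 ≤ 2 * y * z := by positivity
    nlinarith
  have e2 : - (P * (2 * z * D2)) ≤ lam * y ^ 2 * z * (g * b) := by
    have h1 := (abs_le.1 hD2).1
    have h2 : 0 ≤ 2 * P * z := by positivity
    have h3 : 0 ≤ z * (g * b) := by positivity
    nlinarith
  have e3 : P * (2 * z * τ) ≤ lam * k ^ 2 * |Z * τ| := by
    have hZ : 0 ≤ Z := hz.trans hzZ
    rw [abs_mul, abs_of_nonneg hZ]
    have h1 : z * τ ≤ Z * |τ| := by
      calc z * τ ≤ z * |τ| := by gcongr; exact le_abs_self τ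
        _ ≤ _ := by gcongr
    have h2 : 0 ≤ Z * |τ| := by positivity
    calc P * (2 * z * τ) = 2 * P * (z * τ) := by ring
      _ ≤ 2 * P * (Z * |τ|) := by gcongr
      _ ≤ 2 * (1 / 2 * lam * y ^ 2) * (Z * |τ|) := by gcongr
      _ = lam * y ^ 2 * (Z * |τ|) := by ring
      _ ≤ _ := by gcongr
  have e4 : 2 * y * z * (a * g) ≤ 1 / 2 * (a ^ 2 * z ^ 2) + 2 * (y ^ 2 * g ^ 2) := by
    nlinarith [sq_nonneg (a * z - 2 * (y * g))]
  have e5 : lam * y ^ 2 * z * (g * b) ≤ 1 / 2 * (y ^ 2 * g ^ 2)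
      + 1 / 2 * lam ^ 2 * (b ^ 2 * (y * z) ^ 2) := by
    nlinarith [sq_nonneg (y * g - lam * b * y * z)]
  have e6 : lam ^ 2 * (b ^ 2 * (y * z) ^ 2) ≤ lam ^ 2 * (b ^ 2 * (y * Z) ^ 2) := by gcongr
  have e7 : y ^ 2 * g ^ 2 ≤ k ^ 2 * g ^ 2 := by gcongr
  linarith

/-- Bundle of the hypotheses used in the energy estimate. -/
structure EbData (d : ℕ) (m ρ t₀ t₁ μ k l : ℝ) (B : Rd d → ℝ → Rd d) (v ζ : Rd d → ℝ → ℝ) :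
    Prop where
  hm : 1 ≤ m
  hρ : 0 < ρ
  ht : t₀ < t₁
  hl : 0 < l
  hk : 0 < k
  hlk : l = μ - k
  vpos : ∀ x ∈ Metric.ball (0 : Rd d) ρ, ∀ t ∈ Ioc t₀ t₁, 0 < v x t
  vcont : ContinuousOn (fun p : Rd d × ℝ => v p.1 p.2) (Metric.closedBall 0 ρ ×ˢ Icc t₀ t₁)
  vC2 : ∀ t ∈ Ioc t₀ t₁, ContDiffOn ℝ 2 (fun x => v x t) (Metric.ball 0 ρ)
  vder : ∀ x ∈ Metric.ball (0 : Rd d) ρ, ∀ t ∈ Ioo t₀ t₁,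
    HasDerivAt (fun s => v x s) (m * v x t ^ ((m - 1) / m) * lap d (fun y => v y t) x
        + fderiv ℝ (fun y => v y t) x (B x t)) t
  vle : ∀ x ∈ Metric.closedBall (0 : Rd d) ρ, ∀ t ∈ Icc t₀ t₁, v x t ≤ μ
  Bcont : ContinuousOn (fun p : Rd d × ℝ => B p.1 p.2) (Metric.closedBall 0 ρ ×ˢ Ioc t₀ t₁)
  BC1 : ∀ t ∈ Ioc t₀ t₁, ContDiffOn ℝ 1 (fun x => B x t) (Metric.ball 0 ρ)
  Bdiv : ∀ t ∈ Ioc t₀ t₁, ∀ x ∈ Metric.ball (0 : Rd d) ρ, divg d (fun y => B y t) x = 0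
  ζC : ContDiff ℝ (⊤ : ℕ∞) (fun p : Rd d × ℝ => ζ p.1 p.2)
  ζ0 : ∀ x t, 0 ≤ ζ x t
  ζ1 : ∀ x t, ζ x t ≤ 1
  ζs : ∀ x ∈ Metric.sphere (0 : Rd d) ρ, ∀ t ∈ Icc t₀ t₁, ζ x t = 0
  ζi : ∀ x ∈ Metric.closedBall (0 : Rd d) ρ, ζ x t₀ = 0

/-- squared positive part is C¹ -/
lemma eb_sqpos_hasDerivAt (s : ℝ) : HasDerivAt (fun s : ℝ => (max s 0) ^ 2) (2 * max s 0) s := by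
  rcases lt_trichotomy s 0 with h | h | h
  · have : (fun s : ℝ => (max s 0) ^ 2) =ᶠ[𝓝 s] fun _ => 0 := by
      filter_upwards [gt_mem_nhds h] with r hr
      rw [max_eq_right hr.le]; simp
    rw [max_eq_right h.le]
    simpa using (hasDerivAt_const s (0:ℝ)).congr_of_eventuallyEq this
  · subst h
    rw [hasDerivAt_iff_isLittleO_nhds_zero]
    simp only [zero_add, max_self, mul_zero, smul_zero, sub_zero]
    have h1 : (fun h : ℝ => max h 0 ^ 2 - 0 ^ 2) =O[𝓝 0] fun h : ℝ => h ^ 2 := by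
      refine Asymptotics.IsBigO.of_bound 1 (Eventually.of_forall fun h => ?_)
      simp only [ne_eq, OfNat.ofNat_ne_zero, not_false_eq_true, zero_pow, sub_zero, norm_pow,
        Real.norm_eq_abs, one_mul, sq_abs]
      rcases le_total h 0 with h' | h'
      · rw [max_eq_right h']; simpa using sq_nonneg h
      · rw [max_eq_left h']
    refine h1.trans_isLittleO ?_
    exact Asymptotics.isLittleO_pow_id one_lt_two
  · have : (fun s : ℝ => (max s 0) ^ 2) =ᶠ[𝓝 s] fun r => r ^ 2 := by
      filter_upwards [lt_mem_nhds h] with r hr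
      rw [max_eq_left hr.le]
    rw [max_eq_left h.le]
    have h2 := (hasDerivAt_pow 2 s).congr_of_eventuallyEq this
    simpa using h2

lemma eb_sqpos_contDiff : ContDiff ℝ 1 (fun s : ℝ => (max s 0) ^ 2) := by
  rw [contDiff_one_iff_deriv]
  refine ⟨fun s => (eb_sqpos_hasDerivAt s).differentiableAt, ?_⟩
  rw [show deriv (fun s : ℝ => (max s 0) ^ 2) = fun s => 2 * max s 0 from
    funext fun s => (eb_sqpos_hasDerivAt s).deriv]
  fun_prop

namespace EbData
variable {d : ℕ} {m ρ t₀ t₁ μ k l : ℝ} {B : Rd d → ℝ → Rd d} {v ζ : Rd d → ℝ → ℝ}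

lemma ζx (h : EbData d m ρ t₀ t₁ μ k l B v ζ) (t : ℝ) : ContDiff ℝ 1 (fun x => ζ x t) := by
  have h1 : ContDiff ℝ 1 (fun p : Rd d × ℝ => ζ p.1 p.2) := h.ζC.of_le (by exact_mod_cast le_top)
  exact h1.comp (contDiff_id.prodMk contDiff_const)

lemma ζt (h : EbData d m ρ t₀ t₁ μ k l B v ζ) (x : Rd d) : ContDiff ℝ 1 (fun t => ζ x t) := by
  have h1 : ContDiff ℝ 1 (fun p : Rd d × ℝ => ζ p.1 p.2) := h.ζC.of_le (by exact_mod_cast le_top)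
  exact h1.comp (contDiff_const.prodMk contDiff_id)

/-- the support of the truncated cutoff stays away from the lateral boundary -/
lemma exists_radius (h : EbData d m ρ t₀ t₁ μ k l B v ζ) {ε : ℝ} (hε : 0 < ε) :
    ∃ r, 0 < r ∧ r < ρ ∧ ∀ x ∈ Metric.closedBall (0 : Rd d) ρ, ∀ t ∈ Icc t₀ t₁, r < ‖x‖ →
      ζ x t ≤ ε := by
  set S : Set (Rd d × ℝ) := (Metric.closedBall 0 ρ ×ˢ Icc t₀ t₁) ∩ {p | ε ≤ ζ p.1 p.2} with hS
  have hSc : IsCompact S := by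
    apply IsCompact.inter_right ((isCompact_closedBall _ _).prod isCompact_Icc)
    exact isClosed_le continuous_const h.ζC.continuous
  rcases S.eq_empty_or_nonempty with he | hne
  · refine ⟨ρ / 2, by linarith [h.hρ], by linarith [h.hρ], fun x hx t ht _ => ?_⟩
    by_contra hc
    have : (x, t) ∈ S := ⟨⟨hx, ht⟩, le_of_lt (not_le.1 hc)⟩
    rw [he] at this; exact this
  · obtain ⟨⟨x0, s0⟩, ⟨⟨hx0, hs0⟩, hζ0⟩, hmax⟩ :=
      hSc.exists_isMaxOn hne (f := fun p => ‖p.1‖) (by fun_prop)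
    have hlt : ‖x0‖ < ρ := by
      have h1 : ‖x0‖ ≤ ρ := by simpa using hx0
      rcases h1.lt_or_eq with h2 | h2
      · exact h2
      · have := h.ζs x0 (by simpa using h2) s0 hs0
        have hζ0' : ε ≤ ζ x0 s0 := hζ0
        linarith
    refine ⟨max ‖x0‖ (ρ / 2), lt_max_of_lt_right (by linarith [h.hρ]),
      max_lt hlt (by linarith [h.hρ]), fun x hx t ht hr => ?_⟩
    by_contra hc
    have hmem : (x, t) ∈ S := ⟨⟨hx, ht⟩, le_of_lt (not_le.1 hc)⟩
    have h3 : ‖x‖ ≤ ‖x0‖ := isMaxOn_iff.1 hmax (x, t) hmem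
    have := le_max_left ‖x0‖ (ρ / 2)
    linarith

/-- integrand of the time derivative of the energy -/
def orig (m l ε : ℝ) (B : Rd d → ℝ → Rd d) (v ζ : Rd d → ℝ → ℝ) (t : ℝ) (x : Rd d) : ℝ :=
  ebp m l (v x t) * (m * v x t ^ ((m - 1) / m) * lap d (fun y => v y t) x
        + fderiv ℝ (fun y => v y t) x (B x t)) * (max (ζ x t - ε) 0) ^ 2
    + ebP m l (v x t) * (2 * max (ζ x t - ε) 0 * deriv (fun s => ζ x s) t)

def hI (l ε : ℝ) (v ζ : Rd d → ℝ → ℝ) (t : ℝ) (x : Rd d) : ℝ :=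
  {y | l < v y t}.indicator
    (fun y => ‖fderiv ℝ (fun y => v y t) y‖ ^ 2 * (max (ζ y t - ε) 0) ^ 2) x

def gI (l : ℝ) (v ζ : Rd d → ℝ → ℝ) (t : ℝ) (x : Rd d) : ℝ :=
  {y | l < v y t}.indicator (fun y => ‖fderiv ℝ (fun y => ζ y t) y‖ ^ 2) x

def tI (l : ℝ) (v ζ : Rd d → ℝ → ℝ) (t : ℝ) (x : Rd d) : ℝ :=
  {y | l < v y t}.indicator (fun y => |ζ y t * deriv (fun s => ζ y s) t|) x

def bI (l : ℝ) (B : Rd d → ℝ → Rd d) (v ζ : Rd d → ℝ → ℝ) (t : ℝ) (x : Rd d) : ℝ :=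
  ‖B x t‖ ^ 2 * (max (v x t - l) 0 * ζ x t) ^ 2

lemma ebp_mul {s : ℝ} (hm : 1 ≤ m) (hl : 0 < l) (hs : 0 < s) :
    ebp m l s * (m * s ^ ((m - 1) / m)) = max (s - l) 0 := by
  unfold ebp
  rcases le_or_gt s l with h1 | h1
  · rw [max_eq_right (by linarith : s - l ≤ 0)]; ring
  · rw [max_eq_left h1.le, Real.rpow_neg hs.le]
    have : s ^ ((m - 1) / m) ≠ 0 := (Real.rpow_pos_of_pos hs _).ne'
    field_simp

/-- pointwise inequality, in terms of point values -/
lemma pointwise (h : EbData d m ρ t₀ t₁ μ k l B v ζ) (ε : ℝ) (hε : 0 < ε) {t : ℝ}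
    (ht : t ∈ Ioc t₀ t₁) {x : Rd d} (hx : x ∈ Metric.ball (0 : Rd d) ρ) :
    orig m l ε B v ζ t x
      ≤ (- (1 / 2) * hI l ε v ζ t x + 5 / 2 * k ^ 2 * gI l v ζ t x
          + 1 / 2 * (l ^ (-((m - 1) / m))) ^ 2 * bI l B v ζ t x
          + l ^ (-((m - 1) / m)) * k ^ 2 * tI l v ζ t x)
        + ({y | l < v y t}.indicator
            (fun y => ‖fderiv ℝ (fun y => v y t) y‖ ^ 2 * (max (ζ y t - ε) 0) ^ 2) x
          + max (v x t - l) 0 * (lap d (fun y => v y t) x * (max (ζ x t - ε) 0) ^ 2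
            + 2 * max (ζ x t - ε) 0 *
              ∑ i, pd d (fun y => v y t) i x * pd d (fun y => ζ y t) i x))
        + ((max (ζ x t - ε) 0) ^ 2 * ebp m l (v x t) * fderiv ℝ (fun y => v y t) x (B x t)
          + ebP m l (v x t) * (2 * max (ζ x t - ε) 0 * fderiv ℝ (fun y => ζ y t) x (B x t))) := by
  have hlam : 0 ≤ l ^ (-((m - 1) / m)) := Real.rpow_nonneg h.hl.le _
  have hvp := h.vpos x hx t ht
  have hmul := ebp_mul (m := m) (l := l) h.hm h.hl hvp
  have hvle := h.vle x (Metric.ball_subset_closedBall hx) t (Ioc_subset_Icc_self ht)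
  set y := max (v x t - l) 0 with hy
  set z := max (ζ x t - ε) 0 with hz
  have horig : orig m l ε B v ζ t x = y * lap d (fun y => v y t) x * z ^ 2
      + ebp m l (v x t) * fderiv ℝ (fun y => v y t) x (B x t) * z ^ 2
      + ebP m l (v x t) * (2 * z * deriv (fun s => ζ x s) t) := by
    unfold orig
    rw [← hmul]; ring
  rw [horig]
  by_cases hlv : l < v x t
  · have hmem : x ∈ {y | l < v y t} := hlv
    unfold hI gI tI bI
    simp only [indicator_of_mem hmem]
    have hP0 := ebP_nonneg h.hm h.hl (v x t)
    have hP1 := ebP_upper h.hm h.hl (v x t)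
    have hD2 : |fderiv ℝ (fun y => ζ y t) x (B x t)| ≤ ‖fderiv ℝ (fun y => ζ y t) x‖ * ‖B x t‖ := by
      rw [← Real.norm_eq_abs]; exact ContinuousLinearMap.le_opNorm _ _
    have key := eb_alg (m := m) (lam := l ^ (-((m - 1) / m)))
      (a := ‖fderiv ℝ (fun y => v y t) x‖) (g := ‖fderiv ℝ (fun y => ζ y t) x‖) (b := ‖B x t‖)
      (y := y) (z := z) (Z := ζ x t) (P := ebP m l (v x t)) (k := k)
      (τ := deriv (fun s => ζ x s) t)
      (D1 := ∑ i, pd d (fun y => v y t) i x * pd d (fun y => ζ y t) i x)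
      (D2 := fderiv ℝ (fun y => ζ y t) x (B x t))
      h.hm hlam (norm_nonneg _) (norm_nonneg _) (norm_nonneg _) (le_max_right _ _)
      (by rw [hy]; apply max_le
          · rw [h.hlk]; linarith
          · exact h.hk.le) (le_max_right _ _)
      (by rw [hz]; exact max_le (by linarith) (h.ζ0 x t)) hP0 hP1
      (eb_cs _ _) hD2
    linarith
  · have hmem : x ∉ {y | l < v y t} := hlv
    have hy0 : y = 0 := by rw [hy]; exact max_eq_right (by linarith)
    have hP0 : ebP m l (v x t) = 0 := ebP_of_le (not_lt.1 hlv)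
    unfold hI gI tI bI
    simp only [indicator_of_notMem hmem]
    rw [← hy, hy0, hP0]
    apply le_of_eq
    ring
end EbData

lemma eb_int_cpt {d : ℕ} {g : Rd d → ℝ} {r ρ : ℝ} (hr : r < ρ)
    (hg : ContinuousOn g (Metric.ball 0 ρ))
    (hz : ∀ x ∈ Metric.ball (0 : Rd d) ρ, r < ‖x‖ → g x = 0) :
    IntegrableOn g (Metric.ball 0 ρ) := by
  have h1 : IntegrableOn g (Metric.closedBall 0 r) :=
    (hg.mono (Metric.closedBall_subset_ball hr)).integrableOn_compact (isCompact_closedBall _ _)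
  refine h1.of_forall_sdiff_eq_zero measurableSet_ball fun x hx => ?_
  refine hz x hx.1 ?_
  have := hx.2
  simpa using this

/-- set integrals of functions vanishing off the set, finite sums -/
lemma eb_sum_zero {d : ℕ} {A : Rd d → ℝ} {J : Fin d → Rd d → ℝ} {K : Set (Rd d)}
    (hK : MeasurableSet K)
    (hJ : ∀ i, Integrable (J i) ∧ ∫ x, J i x = 0) (hoff : ∀ i, ∀ x ∉ K, J i x = 0)
    (hA : ∀ x ∈ K, A x = ∑ i, J i x) : IntegrableOn A K ∧ ∫ x in K, A x = 0 := by
  have h1 : IntegrableOn (fun x => ∑ i, J i x) K :=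
    (integrable_finsetSum _ fun i _ => (hJ i).1).integrableOn
  refine ⟨h1.congr_fun (fun x hx => (hA x hx).symm) hK, ?_⟩
  rw [setIntegral_congr_fun hK hA, integral_finsetSum _ fun i _ => (hJ i).1.integrableOn]
  refine Finset.sum_eq_zero fun i _ => ?_
  rw [setIntegral_eq_integral_of_forall_compl_eq_zero (fun x hx => hoff i x hx)]
  exact (hJ i).2

namespace EbData
variable {d : ℕ} {m ρ t₀ t₁ μ k l : ℝ} {B : Rd d → ℝ → Rd d} {v ζ : Rd d → ℝ → ℝ}

lemma z_pd (h : EbData d m ρ t₀ t₁ μ k l B v ζ) (ε t : ℝ) (x : Rd d) :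
    HasFDerivAt (fun y => (max (ζ y t - ε) 0) ^ 2)
      ((2 * max (ζ x t - ε) 0) • fderiv ℝ (fun y => ζ y t) x) x := by
  have h1 : HasFDerivAt (fun y => ζ y t - ε) (fderiv ℝ (fun y => ζ y t) x) x :=
    (((h.ζx t).differentiable (by norm_num)) x).hasFDerivAt.sub_const ε
  exact (eb_sqpos_hasDerivAt _).comp_hasFDerivAt x h1

lemma z_contDiff (h : EbData d m ρ t₀ t₁ μ k l B v ζ) (ε t : ℝ) :
    ContDiff ℝ 1 (fun y => (max (ζ y t - ε) 0) ^ 2) :=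
  eb_sqpos_contDiff.comp ((h.ζx t).sub contDiff_const)

lemma exists_eta (h : EbData d m ρ t₀ t₁ μ k l B v ζ) {ε : ℝ} (hε : 0 < ε) {t : ℝ}
    (ht : t ∈ Icc t₀ t₁) : ∃ η : Rd d → ℝ, ∃ r, 0 < r ∧ r < ρ ∧ ContDiff ℝ 1 η ∧
      tsupport η ⊆ Metric.closedBall 0 r ∧
      (∀ x ∈ Metric.ball (0 : Rd d) ρ, η x = (max (ζ x t - ε) 0) ^ 2) ∧
      (∀ x ∈ Metric.ball (0 : Rd d) ρ, r < ‖x‖ → max (ζ x t - ε) 0 = 0) := by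
  obtain ⟨r, hr0, hrρ, hr⟩ := h.exists_radius hε
  let χ : ContDiffBump (0 : Rd d) := ⟨r, (r + ρ) / 2, hr0, by linarith⟩
  have hz : ∀ x ∈ Metric.ball (0 : Rd d) ρ, r < ‖x‖ → max (ζ x t - ε) 0 = 0 := fun x hx hx2 =>
    max_eq_right (by linarith [hr x (Metric.ball_subset_closedBall hx) t ht hx2])
  refine ⟨fun x => χ x * (max (ζ x t - ε) 0) ^ 2, (r + ρ) / 2, by linarith, by linarith,
    χ.contDiff.mul (h.z_contDiff ε t), ?_, ?_, ?_⟩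
  · refine (tsupport_mul_subset_left).trans ?_
    rw [χ.tsupport_eq]
  · intro x hx
    rcases le_or_gt ‖x‖ r with h1 | h1
    · have : χ x = 1 := χ.one_of_mem_closedBall (by simpa using h1)
      simp [this]
    · simp [hz x hx h1]
  · intro x hx hx2
    exact hz x hx (by linarith)

lemma bracketA (h : EbData d m ρ t₀ t₁ μ k l B v ζ) {ε : ℝ} (hε : 0 < ε) {t : ℝ}
    (ht : t ∈ Ioc t₀ t₁) {A : Rd d → ℝ} (hA : A = fun x => {y | l < v y t}.indicator
            (fun y => ‖fderiv ℝ (fun y => v y t) y‖ ^ 2 * (max (ζ y t - ε) 0) ^ 2) x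
          + max (v x t - l) 0 * (lap d (fun y => v y t) x * (max (ζ x t - ε) 0) ^ 2
            + 2 * max (ζ x t - ε) 0 *
              ∑ i, pd d (fun y => v y t) i x * pd d (fun y => ζ y t) i x)) :
    IntegrableOn A (Metric.ball 0 ρ) ∧ ∫ x in Metric.ball 0 ρ, A x = 0 := by
  obtain ⟨η, r, hr0, hrρ, hη, hηs, hηz, hz0⟩ := h.exists_eta hε (Ioc_subset_Icc_self ht)
  have hηc : HasCompactSupport η :=
    (isCompact_closedBall (0 : Rd d) r).of_isClosed_subset (isClosed_tsupport η) hηs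
  obtain ⟨u, hu, huc, huv⟩ := eb_localize (r := (r + ρ) / 2) (by linarith) (by linarith)
    (n := 2) (h.vC2 t ht)
  have hpη : ∀ x ∈ Metric.ball (0 : Rd d) ρ, ∀ i, pd d η i x
      = 2 * max (ζ x t - ε) 0 * pd d (fun y => ζ y t) i x := by
    intro x hx i
    have h1 : η =ᶠ[𝓝 x] fun y => (max (ζ y t - ε) 0) ^ 2 := by
      filter_upwards [Metric.isOpen_ball.mem_nhds hx] with y hy using hηz y hy
    unfold pd
    rw [h1.fderiv_eq, (h.z_pd ε t x).fderiv]
    simp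
  refine eb_sum_zero measurableSet_ball (J := fun i => ebJ d u η l i)
    (fun i => eb_ibpA hu huc hη hηc l i) ?_ ?_
  · intro i x hx
    have hx' : x ∉ tsupport η := fun hc => hx (Metric.closedBall_subset_ball hrρ (hηs hc))
    have h1 := notMem_tsupport_iff_eventuallyEq.1 hx'
    have h2 : η x = 0 := h1.self_of_nhds
    have h3 : pd d η i x = 0 := by
      unfold pd; rw [h1.fderiv_eq]; simp
    unfold ebJ
    rw [h2, h3]
    simp only [indicator, h2]
    simp
  · intro x hx
    rw [hA]
    by_cases hxr : ‖x‖ < (r + ρ) / 2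
    · have hxb : x ∈ Metric.ball (0 : Rd d) ((r + ρ) / 2) := by simpa using hxr
      have huv' : u =ᶠ[𝓝 x] fun y => v y t := by
        filter_upwards [Metric.isOpen_ball.mem_nhds hxb] with y hy
        exact huv y (Metric.ball_subset_closedBall hy)
      have hux : u x = v x t := huv'.self_of_nhds
      have hp : ∀ i, pd d u i x = pd d (fun y => v y t) i x := fun i => by
        unfold pd; rw [huv'.fderiv_eq]
      have hpp : ∀ i, pd d (fun y => pd d u i y) i x
          = pd d (fun y => pd d (fun y => v y t) i y) i x := fun i => by
        have : (fun y => pd d u i y) =ᶠ[𝓝 x] fun y => pd d (fun y => v y t) i y := by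
          filter_upwards [huv'.eventuallyEq_nhds] with y hy
          unfold pd; rw [hy.fderiv_eq]
        exact congrArg (fun L : Rd d →L[ℝ] ℝ => L (EuclideanSpace.single i 1)) this.fderiv_eq
      have hind : ∀ i, {y | l < u y}.indicator (fun y => pd d u i y ^ 2 * η y) x
          = {y | l < v y t}.indicator
            (fun y => pd d (fun y => v y t) i y ^ 2 * (max (ζ y t - ε) 0) ^ 2) x := by
        intro i
        by_cases hl : l < v x t
        · rw [indicator_of_mem (show x ∈ {y | l < u y} by show l < u x; rw [hux]; exact hl),
            indicator_of_mem (show x ∈ {y | l < v y t} from hl), hp, hηz x hx]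
        · rw [indicator_of_notMem (show x ∉ {y | l < u y} by
              intro hc; apply hl; rw [← hux]; exact hc),
            indicator_of_notMem (show x ∉ {y | l < v y t} from hl)]
      have hind2 : {y | l < v y t}.indicator
            (fun y => ‖fderiv ℝ (fun y => v y t) y‖ ^ 2 * (max (ζ y t - ε) 0) ^ 2) x
          = ∑ i, {y | l < v y t}.indicator
            (fun y => pd d (fun y => v y t) i y ^ 2 * (max (ζ y t - ε) 0) ^ 2) x := by
        by_cases hl : l < v x t
        · have hm : x ∈ {y | l < v y t} := hl
          simp only [indicator_of_mem hm]
          rw [eb_norm_sq, Finset.sum_mul]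
          rfl
        · have hm : x ∉ {y | l < v y t} := hl
          simp only [indicator_of_notMem hm]
          simp
      unfold ebJ
      simp only [hind, hux, hp, hpp, hpη x hx, hηz x hx]
      rw [Finset.sum_add_distrib, ← hind2, ← Finset.mul_sum, Finset.sum_add_distrib,
        ← Finset.sum_mul, Finset.mul_sum (a := 2 * max (ζ x t - ε) 0)]
      unfold lap
      congr 3
      refine Finset.sum_congr rfl fun i _ => ?_
      ring
    · have h0 := hz0 x hx (by linarith)
      have h1 : η x = 0 := by rw [hηz x hx, h0]; simp
      have h2 : ∀ i, pd d η i x = 0 := fun i => by rw [hpη x hx, h0]; simp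
      unfold ebJ
      simp only [h2, h1, indicator, h0]
      simp

lemma bracketB (h : EbData d m ρ t₀ t₁ μ k l B v ζ) {ε : ℝ} (hε : 0 < ε) {t : ℝ}
    (ht : t ∈ Ioc t₀ t₁) {A : Rd d → ℝ} (hA : A = fun x =>
        (max (ζ x t - ε) 0) ^ 2 * ebp m l (v x t) * fderiv ℝ (fun y => v y t) x (B x t)
          + ebP m l (v x t) * (2 * max (ζ x t - ε) 0 * fderiv ℝ (fun y => ζ y t) x (B x t))) :
    IntegrableOn A (Metric.ball 0 ρ) ∧ ∫ x in Metric.ball 0 ρ, A x = 0 := by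
  obtain ⟨η, r, hr0, hrρ, hη, hηs, hηz, hz0⟩ := h.exists_eta hε (Ioc_subset_Icc_self ht)
  have hηc : HasCompactSupport η :=
    (isCompact_closedBall (0 : Rd d) r).of_isClosed_subset (isClosed_tsupport η) hηs
  have hBi : ∀ i, ContDiffOn ℝ 1 (fun x => B x t i) (Metric.ball 0 ρ) := fun i =>
    (EuclideanSpace.proj (𝕜 := ℝ) i).contDiff.comp_contDiffOn (h.BC1 t ht)
  have hPv : ContDiffOn ℝ 1 (fun x => ebP m l (v x t)) (Metric.ball 0 ρ) :=
    (ebP_contDiff h.hl).comp_contDiffOn ((h.vC2 t ht).of_le (by norm_num))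
  have hsub : tsupport η ⊆ Metric.ball 0 ρ := hηs.trans (Metric.closedBall_subset_ball hrρ)
  refine eb_sum_zero measurableSet_ball
    (J := fun i x => pd d (fun y => η y * (ebP m l (v y t) * B y t i)) i x)
    (fun i => eb_ibpB (eb_contDiff_mul (n := 1) Metric.isOpen_ball hη hsub (hPv.mul (hBi i)))
      hηc.mul_right i) ?_ ?_
  · intro i x hx
    have hx' : x ∉ tsupport η := fun hc => hx (hsub hc)
    have h1 := notMem_tsupport_iff_eventuallyEq.1 hx'
    have h2 : (fun y => η y * (ebP m l (v y t) * B y t i)) =ᶠ[𝓝 x] fun _ => 0 := by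
      filter_upwards [h1] with y hy
      rw [hy]; simp
    show pd d _ i x = 0
    unfold pd; rw [h2.fderiv_eq]; simp
  · intro x hx
    have hn := Metric.isOpen_ball.mem_nhds hx
    have hηx : DifferentiableAt ℝ η x := (hη.differentiable (by norm_num)) x
    have hPx : DifferentiableAt ℝ (fun y => ebP m l (v y t)) x :=
      (hPv.contDiffAt hn).differentiableAt (by norm_num)
    have hBx : ∀ i, DifferentiableAt ℝ (fun y => B y t i) x := fun i =>
      ((hBi i).contDiffAt hn).differentiableAt (by norm_num)
    have hvx : DifferentiableAt ℝ (fun y => v y t) x :=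
      ((h.vC2 t ht).contDiffAt hn).differentiableAt (by norm_num)
    have hpη : ∀ i, pd d η i x = 2 * max (ζ x t - ε) 0 * pd d (fun y => ζ y t) i x := by
      intro i
      have h1 : η =ᶠ[𝓝 x] fun y => (max (ζ y t - ε) 0) ^ 2 := by
        filter_upwards [Metric.isOpen_ball.mem_nhds hx] with y hy using hηz y hy
      unfold pd
      rw [h1.fderiv_eq, (h.z_pd ε t x).fderiv]
      simp
    have hpP : ∀ i, pd d (fun y => ebP m l (v y t)) i x
        = ebp m l (v x t) * pd d (fun y => v y t) i x := by
      intro i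
      have := (ebP_hasDerivAt (m := m) h.hl (v x t)).comp_hasFDerivAt x hvx.hasFDerivAt
      unfold pd
      rw [show (fun y => ebP m l (v y t)) = ebP m l ∘ (fun y => v y t) from rfl, this.fderiv]
      simp
    have hdiv := h.Bdiv t ht x hx
    unfold divg at hdiv
    have hterm : ∀ i, pd d (fun y => η y * (ebP m l (v y t) * B y t i)) i x
        = (max (ζ x t - ε) 0) ^ 2 * ebp m l (v x t) * (B x t i * pd d (fun y => v y t) i x)
          + (ebP m l (v x t) * (2 * max (ζ x t - ε) 0)) * (B x t i * pd d (fun y => ζ y t) i x)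
          + ((max (ζ x t - ε) 0) ^ 2 * ebP m l (v x t)) * pd d (fun y => B y t i) i x := by
      intro i
      rw [eb_pd_mul hηx (g := fun y => ebP m l (v y t) * B y t i) (hPx.mul (hBx i)), eb_pd_mul hPx (hBx i), hpη, hpP, hηz x hx]
      ring
    rw [hA]
    simp only [hterm]
    rw [Finset.sum_add_distrib, Finset.sum_add_distrib, ← Finset.mul_sum, ← Finset.mul_sum,
      ← Finset.mul_sum, hdiv, eb_clm_apply, eb_clm_apply (fderiv ℝ (fun y => ζ y t) x)]
    unfold pd
    ring
end EbData

namespace EbData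
variable {d : ℕ} {m ρ t₀ t₁ μ k l : ℝ} {B : Rd d → ℝ → Rd d} {v ζ : Rd d → ℝ → ℝ}

lemma vcx (h : EbData d m ρ t₀ t₁ μ k l B v ζ) {t : ℝ} (ht : t ∈ Icc t₀ t₁) :
    ContinuousOn (fun x => v x t) (Metric.closedBall 0 ρ) :=
  h.vcont.comp (f := fun x => (x, t)) (by fun_prop) fun x hx => ⟨hx, ht⟩

lemma Bcx (h : EbData d m ρ t₀ t₁ μ k l B v ζ) {t : ℝ} (ht : t ∈ Ioc t₀ t₁) :
    ContinuousOn (fun x => B x t) (Metric.closedBall 0 ρ) :=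
  h.Bcont.comp (f := fun x => (x, t)) (by fun_prop) fun x hx => ⟨hx, ht⟩

lemma open_set (h : EbData d m ρ t₀ t₁ μ k l B v ζ) {t : ℝ} (ht : t ∈ Icc t₀ t₁) :
    IsOpen (Metric.ball 0 ρ ∩ {y | l < v y t}) :=
  ((h.vcx ht).mono Metric.ball_subset_closedBall).isOpen_inter_preimage Metric.isOpen_ball
    isOpen_Ioi

lemma ind_int (h : EbData d m ρ t₀ t₁ μ k l B v ζ) {t : ℝ} (ht : t ∈ Icc t₀ t₁) {g : Rd d → ℝ}
    (hg : IntegrableOn g (Metric.ball 0 ρ)) :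
    IntegrableOn ({y | l < v y t}.indicator g) (Metric.ball 0 ρ) := by
  have h1 : IntegrableOn ((Metric.ball 0 ρ ∩ {y | l < v y t}).indicator g) (Metric.ball 0 ρ) :=
    hg.indicator (h.open_set ht).measurableSet
  refine h1.congr_fun (fun x hx => ?_) measurableSet_ball
  by_cases hl : l < v x t
  · rw [indicator_of_mem (show x ∈ Metric.ball 0 ρ ∩ {y | l < v y t} from ⟨hx, hl⟩),
      indicator_of_mem (show x ∈ {y | l < v y t} from hl)]
  · rw [indicator_of_notMem (show x ∉ Metric.ball 0 ρ ∩ {y | l < v y t} from fun hc => hl hc.2),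
      indicator_of_notMem (show x ∉ {y | l < v y t} from hl)]

lemma fder_cont (h : EbData d m ρ t₀ t₁ μ k l B v ζ) {t : ℝ} (ht : t ∈ Ioc t₀ t₁) :
    ContinuousOn (fun x => fderiv ℝ (fun y => v y t) x) (Metric.ball 0 ρ) :=
  ((h.vC2 t ht).continuousOn_fderiv_of_isOpen Metric.isOpen_ball (by norm_num))

lemma lap_cont (h : EbData d m ρ t₀ t₁ μ k l B v ζ) {t : ℝ} (ht : t ∈ Ioc t₀ t₁) :
    ContinuousOn (fun x => lap d (fun y => v y t) x) (Metric.ball 0 ρ) := by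
  unfold lap
  refine continuousOn_finsetSum _ fun i _ => ?_
  have h1 : ContDiffOn ℝ 1 (fun y => pd d (fun y => v y t) i y) (Metric.ball 0 ρ) := fun x hx =>
    (eb_pd_contDiffAt ((h.vC2 t ht).contDiffAt (Metric.isOpen_ball.mem_nhds hx)) i).contDiffWithinAt
  exact (h1.continuousOn_fderiv_of_isOpen Metric.isOpen_ball (by norm_num)).clm_apply
    continuousOn_const

lemma ζc (h : EbData d m ρ t₀ t₁ μ k l B v ζ) (t : ℝ) : Continuous (fun x => ζ x t) :=
  (h.ζx t).continuous

lemma ζdt_joint (h : EbData d m ρ t₀ t₁ μ k l B v ζ) :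
    Continuous (fun p : Rd d × ℝ => deriv (fun s => ζ p.1 s) p.2) := by
  have hd : Differentiable ℝ (fun p : Rd d × ℝ => ζ p.1 p.2) := h.ζC.differentiable (by simp)
  have h1 : (fun p : Rd d × ℝ => deriv (fun s => ζ p.1 s) p.2)
      = fun p => fderiv ℝ (fun p : Rd d × ℝ => ζ p.1 p.2) p (0, 1) := by
    ext p
    have h2 : HasDerivAt (fun s : ℝ => (p.1, s)) ((0 : Rd d), (1 : ℝ)) p.2 :=
      (hasDerivAt_const p.2 p.1).prodMk (hasDerivAt_id p.2)
    have h3 := (hd (p.1, p.2)).hasFDerivAt.comp_hasDerivAt p.2 h2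
    exact h3.deriv
  rw [h1]
  exact (h.ζC.continuous_fderiv (by simp)).clm_apply continuous_const

lemma ζdx_joint (h : EbData d m ρ t₀ t₁ μ k l B v ζ) :
    Continuous (fun p : Rd d × ℝ => ‖fderiv ℝ (fun y => ζ y p.2) p.1‖ ^ 2) := by
  have hd : Differentiable ℝ (fun p : Rd d × ℝ => ζ p.1 p.2) := h.ζC.differentiable (by simp)
  have h1 : ∀ i, (fun p : Rd d × ℝ => fderiv ℝ (fun y => ζ y p.2) p.1 (EuclideanSpace.single i 1))
      = fun p => fderiv ℝ (fun p : Rd d × ℝ => ζ p.1 p.2) p (EuclideanSpace.single i 1, 0) := by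
    intro i
    ext p
    have h2 : HasFDerivAt (fun y : Rd d => (y, p.2))
        ((ContinuousLinearMap.id ℝ (Rd d)).prod (0 : Rd d →L[ℝ] ℝ)) p.1 :=
      (hasFDerivAt_id p.1).prodMk (hasFDerivAt_const p.2 p.1)
    have h3 := (hd (p.1, p.2)).hasFDerivAt.comp p.1 h2
    have h4 : fderiv ℝ (fun y => ζ y p.2) p.1 = _ := h3.fderiv
    rw [h4]; simp
  simp only [eb_norm_sq]
  refine continuous_finsetSum _ fun i _ => ?_
  refine Continuous.pow ?_ 2
  rw [h1 i]
  exact (h.ζC.continuous_fderiv (by simp)).clm_apply continuous_const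

lemma cont_int {g : Rd d → ℝ} (hg : ContinuousOn g (Metric.closedBall 0 ρ)) :
    IntegrableOn g (Metric.ball 0 ρ) :=
  (hg.integrableOn_compact (isCompact_closedBall _ _)).mono_set Metric.ball_subset_closedBall

lemma gI_int (h : EbData d m ρ t₀ t₁ μ k l B v ζ) {t : ℝ} (ht : t ∈ Icc t₀ t₁) :
    IntegrableOn (gI l v ζ t) (Metric.ball 0 ρ) :=
  h.ind_int ht (cont_int (h.ζdx_joint.comp (f := fun x => (x, t)) (by fun_prop)).continuousOn)

lemma tI_int (h : EbData d m ρ t₀ t₁ μ k l B v ζ) {t : ℝ} (ht : t ∈ Icc t₀ t₁) :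
    IntegrableOn (tI l v ζ t) (Metric.ball 0 ρ) :=
  h.ind_int ht (cont_int (((h.ζc t).mul
    (h.ζdt_joint.comp (f := fun x => (x, t)) (by fun_prop))).abs).continuousOn)

lemma bI_int (h : EbData d m ρ t₀ t₁ μ k l B v ζ) {t : ℝ} (ht : t ∈ Ioc t₀ t₁) :
    IntegrableOn (bI l B v ζ t) (Metric.ball 0 ρ) := by
  apply cont_int
  unfold bI
  have h1 := h.Bcx ht
  have h2 := h.vcx (Ioc_subset_Icc_self ht)
  have h3 := (h.ζc t).continuousOn (s := Metric.closedBall 0 ρ)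
  exact (h1.norm.pow 2).mul ((((h2.sub continuousOn_const).sup continuousOn_const).mul h3).pow 2)

lemma hI_int (h : EbData d m ρ t₀ t₁ μ k l B v ζ) {ε : ℝ} (hε : 0 < ε) {t : ℝ}
    (ht : t ∈ Ioc t₀ t₁) : IntegrableOn (hI l ε v ζ t) (Metric.ball 0 ρ) := by
  obtain ⟨η, r, hr0, hrρ, hη, hηs, hηz, hz0⟩ := h.exists_eta hε (Ioc_subset_Icc_self ht)
  refine h.ind_int (Ioc_subset_Icc_self ht) (eb_int_cpt hrρ ?_ ?_)
  · exact ((h.fder_cont ht).norm.pow 2).mul (h.z_contDiff ε t).continuous.continuousOn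
  · intro x hx hx2
    simp [hz0 x hx hx2]

lemma orig_int (h : EbData d m ρ t₀ t₁ μ k l B v ζ) {ε : ℝ} (hε : 0 < ε) {t : ℝ}
    (ht : t ∈ Ioc t₀ t₁) : IntegrableOn (orig m l ε B v ζ t) (Metric.ball 0 ρ) := by
  obtain ⟨η, r, hr0, hrρ, hη, hηs, hηz, hz0⟩ := h.exists_eta hε (Ioc_subset_Icc_self ht)
  refine eb_int_cpt hrρ ?_ ?_
  · unfold orig
    have h2 := (h.vcx (Ioc_subset_Icc_self ht)).mono Metric.ball_subset_closedBall
    have h1 := (h.Bcx ht).mono Metric.ball_subset_closedBall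
    have h3 : ContinuousOn (fun x => v x t ^ ((m - 1) / m)) (Metric.ball 0 ρ) :=
      h2.rpow_const fun x hx => Or.inl (h.vpos x hx t ht).ne'
    have h4 : ContinuousOn (fun x => max (ζ x t - ε) 0) (Metric.ball 0 ρ) :=
      (((h.ζc t).sub continuous_const).sup continuous_const).continuousOn
    have h5 : ContinuousOn (fun x => deriv (fun s => ζ x s) t) (Metric.ball 0 ρ) :=
      (h.ζdt_joint.comp (f := fun x => (x, t)) (by fun_prop)).continuousOn
    have h6 := (ebp_continuous (m := m) h.hl).comp_continuousOn h2
    have h7 := (ebP_contDiff (m := m) h.hl).continuous.comp_continuousOn h2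
    exact ((h6.mul (((continuousOn_const.mul h3).mul (h.lap_cont ht)).add
      ((h.fder_cont ht).clm_apply h1))).mul (h4.pow 2)).add
        (h7.mul ((continuousOn_const.mul h4).mul h5))
  · intro x hx hx2
    unfold orig
    simp [hz0 x hx hx2]

/-- energy inequality at a fixed time -/
lemma fixed_time (h : EbData d m ρ t₀ t₁ μ k l B v ζ) {ε : ℝ} (hε : 0 < ε) {t : ℝ}
    (ht : t ∈ Ioc t₀ t₁) :
    ∫ x in Metric.ball 0 ρ, orig m l ε B v ζ t x
      ≤ - (1 / 2) * (∫ x in Metric.ball 0 ρ, hI l ε v ζ t x)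
        + 5 / 2 * k ^ 2 * (∫ x in Metric.ball 0 ρ, gI l v ζ t x)
        + 1 / 2 * (l ^ (-((m - 1) / m))) ^ 2 * (∫ x in Metric.ball 0 ρ, bI l B v ζ t x)
        + l ^ (-((m - 1) / m)) * k ^ 2 * (∫ x in Metric.ball 0 ρ, tI l v ζ t x) := by
  have ht' := Ioc_subset_Icc_self ht
  obtain ⟨hA, hA0⟩ := h.bracketA hε ht rfl
  obtain ⟨hB, hB0⟩ := h.bracketB hε ht rfl
  have i1 := (h.hI_int hε ht).const_mul (- (1 / 2))
  have i2 := (h.gI_int ht').const_mul (5 / 2 * k ^ 2)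
  have i3 := (h.bI_int ht).const_mul (1 / 2 * (l ^ (-((m - 1) / m))) ^ 2)
  have i4 := (h.tI_int ht').const_mul (l ^ (-((m - 1) / m)) * k ^ 2)
  have h1 := setIntegral_mono_on (h.orig_int hε ht) (((((i1.add i2).add i3).add i4).add hA).add hB)
    measurableSet_ball (fun x hx => h.pointwise ε hε ht hx)
  refine h1.trans (le_of_eq ?_)
  rw [integral_add' ((((i1.add i2).add i3).add i4).add hA) hB, hB0,
    integral_add' (((i1.add i2).add i3).add i4) hA, hA0, integral_add' ((i1.add i2).add i3) i4,
    integral_add' (i1.add i2) i3, integral_add' i1 i2]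
  simp only [integral_const_mul, add_zero]
end EbData

namespace EbData
variable {d : ℕ} {m ρ t₀ t₁ μ k l : ℝ} {B : Rd d → ℝ → Rd d} {v ζ : Rd d → ℝ → ℝ}

/-- the truncated energy density -/
def eD (m l ε : ℝ) (v ζ : Rd d → ℝ → ℝ) (t : ℝ) (x : Rd d) : ℝ :=
  ebP m l (v x t) * (max (ζ x t - ε) 0) ^ 2

lemma v_nonneg (h : EbData d m ρ t₀ t₁ μ k l B v ζ) {x : Rd d} (hx : x ∈ Metric.ball (0 : Rd d) ρ)
    {t : ℝ} (ht : t ∈ Ioc t₀ t₁) : v x t ∈ Icc 0 μ :=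
  ⟨(h.vpos x hx t ht).le, h.vle x (Metric.ball_subset_closedBall hx) t (Ioc_subset_Icc_self ht)⟩

/-- forward-in-time Lipschitz bound -/
lemma lip_forward (h : EbData d m ρ t₀ t₁ μ k l B v ζ) {t r : ℝ} (ht : t ∈ Ioo t₀ t₁)
    (hr0 : 0 < r) (hr : r < ρ) : ∃ N δ : ℝ, 0 ≤ N ∧ 0 < δ ∧ t + δ < t₁ ∧
      ∀ x ∈ Metric.closedBall (0 : Rd d) r, ∀ s ∈ Icc t (t + δ), |v x s - v x t| ≤ N * (s - t) := by
  set s1 := (t + t₁) / 2 with hs1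
  have hts : t < s1 := by rw [hs1]; linarith [ht.2]
  have hst : s1 < t₁ := by rw [hs1]; linarith [ht.2]
  have hsub : Icc t s1 ⊆ Ioo t₀ t₁ := fun s hs => ⟨lt_of_lt_of_le ht.1 hs.1, lt_of_le_of_lt hs.2 hst⟩
  have hsub1 : Icc t s1 ⊆ Ioc t₀ t₁ := hsub.trans Ioo_subset_Ioc_self
  have hsub2 : Icc t s1 ⊆ Icc t₀ t₁ := hsub.trans Ioo_subset_Icc_self
  have hc := h.vcont.mono (prod_mono (Subset.refl (Metric.closedBall (0 : Rd d) ρ)) hsub2)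
  have hBc := h.Bcont.mono (prod_mono (Subset.refl (Metric.closedBall (0 : Rd d) ρ)) hsub1)
  obtain ⟨B0, hB0⟩ := ((isCompact_closedBall (0 : Rd d) ρ).prod
    (isCompact_Icc (a := t) (b := s1))).exists_bound_of_continuousOn hBc
  have hβ : 0 ≤ (m - 1) / m := div_nonneg (by linarith [h.hm]) (by linarith [h.hm])
  have hm0 : 0 ≤ m := by linarith [h.hm]
  have ha0 : ∀ x ∈ Metric.ball (0 : Rd d) ρ, ∀ s ∈ Icc t s1, 0 ≤ m * v x s ^ ((m - 1) / m) :=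
    fun x hx s hs => mul_nonneg hm0 (Real.rpow_nonneg (h.v_nonneg hx (hsub1 hs)).1 _)
  have ha1 : ∀ x ∈ Metric.ball (0 : Rd d) ρ, ∀ s ∈ Icc t s1,
      m * v x s ^ ((m - 1) / m) ≤ m * μ ^ ((m - 1) / m) := fun x hx s hs =>
    mul_le_mul_of_nonneg_left (Real.rpow_le_rpow (h.v_nonneg hx (hsub1 hs)).1
      (h.v_nonneg hx (hsub1 hs)).2 hβ) hm0
  have hb : ∀ x ∈ Metric.ball (0 : Rd d) ρ, ∀ s ∈ Icc t s1, ‖B x s‖ ≤ B0 := fun x hx s hs =>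
    hB0 (x, s) ⟨Metric.ball_subset_closedBall hx, hs⟩
  obtain ⟨N1, δ1, hN1, hδ1, hd1, H1⟩ := eb_barrier (u := v)
    (a := fun x s => m * v x s ^ ((m - 1) / m)) (b := B) hr0 hr hts hc
    (fun s hs => h.vC2 s (hsub1 hs))
    (fun x hx s hs => h.vder x hx s (hsub (Ioc_subset_Icc_self hs))) ha0 ha1 hb
  obtain ⟨N2, δ2, hN2, hδ2, hd2, H2⟩ := eb_barrier (u := fun x s => - v x s)
    (a := fun x s => m * v x s ^ ((m - 1) / m)) (b := B) hr0 hr hts hc.neg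
    (fun s hs => (h.vC2 s (hsub1 hs)).neg)
    (fun x hx s hs => by
      have h1 := (h.vder x hx s (hsub (Ioc_subset_Icc_self hs))).neg
      have h2 : fderiv ℝ (fun y => - v y s) x = - fderiv ℝ (fun y => v y s) x := fderiv_neg
      rw [eb_lap_neg, h2]
      have h3 : m * v x s ^ ((m - 1) / m) * -lap d (fun y => v y s) x
          + (-fderiv ℝ (fun y => v y s) x) (B x s)
          = -(m * v x s ^ ((m - 1) / m) * lap d (fun y => v y s) x
            + fderiv ℝ (fun y => v y s) x (B x s)) := by
        rw [neg_apply]; ring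
      exact h3 ▸ h1) ha0 ha1 hb
  refine ⟨max N1 N2, min δ1 δ2, le_max_of_le_left hN1, lt_min hδ1 hδ2, ?_, ?_⟩
  · have := min_le_left δ1 δ2
    linarith
  · intro x hx s hs
    have e1 := min_le_left δ1 δ2
    have e2 := min_le_right δ1 δ2
    have a1 := H1 x hx s ⟨hs.1, by linarith [hs.2]⟩
    have a2 := H2 x hx s ⟨hs.1, by linarith [hs.2]⟩
    have b1 : N1 * (s - t) ≤ max N1 N2 * (s - t) :=
      mul_le_mul_of_nonneg_right (le_max_left _ _) (by linarith [hs.1])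
    have b2 : N2 * (s - t) ≤ max N1 N2 * (s - t) :=
      mul_le_mul_of_nonneg_right (le_max_right _ _) (by linarith [hs.1])
    rw [abs_le]
    constructor <;> linarith

lemma eD_cont (h : EbData d m ρ t₀ t₁ μ k l B v ζ) (ε : ℝ) :
    ContinuousOn (fun p : Rd d × ℝ => eD m l ε v ζ p.2 p.1)
      (Metric.closedBall 0 ρ ×ˢ Icc t₀ t₁) := by
  unfold eD
  have h7 := (ebP_contDiff (m := m) h.hl).continuous.comp_continuousOn h.vcont
  exact h7.mul ((((h.ζC.continuous).sub continuous_const).sup continuous_const).pow 2).continuousOn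

lemma eD_contx (h : EbData d m ρ t₀ t₁ μ k l B v ζ) (ε : ℝ) {t : ℝ} (ht : t ∈ Icc t₀ t₁) :
    ContinuousOn (eD m l ε v ζ t) (Metric.closedBall 0 ρ) :=
  (h.eD_cont ε).comp (f := fun x => (x, t)) (by fun_prop) fun x hx => ⟨hx, ht⟩

lemma E_cont (h : EbData d m ρ t₀ t₁ μ k l B v ζ) (ε : ℝ) :
    ContinuousOn (fun t => ∫ x in Metric.ball 0 ρ, eD m l ε v ζ t x) (Icc t₀ t₁) := by
  obtain ⟨M, hM⟩ := ((isCompact_closedBall (0 : Rd d) ρ).prod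
    (isCompact_Icc (a := t₀) (b := t₁))).exists_bound_of_continuousOn (h.eD_cont ε)
  refine continuousOn_of_dominated (bound := fun _ => M) ?_ ?_ ?_ ?_
  · intro t ht
    exact (cont_int (h.eD_contx ε ht)).aestronglyMeasurable
  · intro t ht
    filter_upwards [ae_restrict_mem measurableSet_ball] with x hx
    exact hM (x, t) ⟨Metric.ball_subset_closedBall hx, ht⟩
  · exact integrableOn_const (by exact measure_ball_lt_top.ne)
  · filter_upwards [ae_restrict_mem measurableSet_ball] with x hx
    exact (h.eD_cont ε).comp (f := fun t => (x, t)) (by fun_prop)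
      fun t ht => ⟨Metric.ball_subset_closedBall hx, ht⟩

lemma eD_hasDerivAt (h : EbData d m ρ t₀ t₁ μ k l B v ζ) (ε : ℝ) {t : ℝ} (ht : t ∈ Ioo t₀ t₁)
    {x : Rd d} (hx : x ∈ Metric.ball (0 : Rd d) ρ) :
    HasDerivAt (fun s => eD m l ε v ζ s x) (orig m l ε B v ζ t x) t := by
  have h1 := (ebP_hasDerivAt (m := m) h.hl (v x t)).comp t (h.vder x hx t ht)
  have h2 : HasDerivAt (fun s => ζ x s - ε) (deriv (fun s => ζ x s) t) t :=
    ((((h.ζt x).differentiable (by norm_num)) t).hasDerivAt).sub_const ε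
  have h3 := (eb_sqpos_hasDerivAt (ζ x t - ε)).comp t h2
  exact h1.mul h3

/-- Lipschitz estimate for the density -/
lemma eD_lip (h : EbData d m ρ t₀ t₁ μ k l B v ζ) {ε : ℝ} (hε : 0 < ε) {t : ℝ}
    (ht : t ∈ Ioo t₀ t₁) : ∃ C δ : ℝ, 0 < δ ∧ t + δ < t₁ ∧ ∀ x ∈ Metric.ball (0 : Rd d) ρ,
      ∀ s ∈ Icc t (t + δ), |eD m l ε v ζ s x - eD m l ε v ζ t x| ≤ C * (s - t) := by
  obtain ⟨r, hr0, hrρ, hr⟩ := h.exists_radius hε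
  obtain ⟨N, δ, hN, hδ, hδt, HN⟩ := h.lip_forward ht hr0 hrρ
  obtain ⟨Mp, hMp⟩ := (isCompact_Icc (a := (0:ℝ)) (b := μ)).exists_bound_of_continuousOn
    (ebp_continuous (m := m) h.hl).continuousOn
  obtain ⟨MP, hMP⟩ := (isCompact_Icc (a := (0:ℝ)) (b := μ)).exists_bound_of_continuousOn
    (ebP_contDiff (m := m) h.hl).continuous.continuousOn
  obtain ⟨Mt, hMt⟩ := ((isCompact_closedBall (0 : Rd d) ρ).prod
    (isCompact_Icc (a := t₀) (b := t₁))).exists_bound_of_continuousOn h.ζdt_joint.continuousOn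
  refine ⟨Mp * N + MP * (2 * Mt), δ, hδ, hδt, fun x hx s hs => ?_⟩
  have hst : 0 ≤ s - t := by linarith [hs.1]
  have hsI : s ∈ Ioc t₀ t₁ := ⟨lt_of_lt_of_le ht.1 hs.1, by linarith [hs.2]⟩
  have htI : t ∈ Ioc t₀ t₁ := Ioo_subset_Ioc_self ht
  have hxc := Metric.ball_subset_closedBall hx
  have hMp0 : 0 ≤ Mp := (norm_nonneg _).trans (hMp _ (h.v_nonneg hx htI))
  have hMP0 : 0 ≤ MP := (norm_nonneg _).trans (hMP _ (h.v_nonneg hx htI))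
  have hMt0 : 0 ≤ Mt := (norm_nonneg _).trans (hMt (x, t) ⟨hxc, Ioc_subset_Icc_self htI⟩)
  have hzle : ∀ s, max (ζ x s - ε) 0 ≤ 1 := fun s =>
    max_le (by linarith [h.ζ1 x s]) zero_le_one
  have hz0 : ∀ s, 0 ≤ max (ζ x s - ε) 0 := fun s => le_max_right _ _
  rcases le_or_gt ‖x‖ r with hxr | hxr
  · have hP : |ebP m l (v x s) - ebP m l (v x t)| ≤ Mp * |v x s - v x t| :=
      (convex_Icc (0:ℝ) μ).norm_image_sub_le_of_norm_hasDerivWithin_le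
        (f := ebP m l) (f' := ebp m l) (fun y _ => (ebP_hasDerivAt h.hl y).hasDerivWithinAt) hMp
        (h.v_nonneg hx htI) (h.v_nonneg hx hsI)
    have hv := HN x (by simpa using hxr) s hs
    have hz : |max (ζ x s - ε) 0 ^ 2 - max (ζ x t - ε) 0 ^ 2| ≤ (2 * Mt) * |s - t| := by
      refine (convex_Icc t₀ t₁).norm_image_sub_le_of_norm_hasDerivWithin_le
        (f := fun s => max (ζ x s - ε) 0 ^ 2)
        (f' := fun s => 2 * max (ζ x s - ε) 0 * deriv (fun s => ζ x s) s) (fun y _ => ?_)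
        (fun y hy => ?_) (Ioc_subset_Icc_self htI) (Ioc_subset_Icc_self hsI)
      · have h2 : HasDerivAt (fun s => ζ x s - ε) (deriv (fun s => ζ x s) y) y :=
          ((((h.ζt x).differentiable (by norm_num)) y).hasDerivAt).sub_const ε
        exact ((eb_sqpos_hasDerivAt (ζ x y - ε)).comp y h2).hasDerivWithinAt
      · have h1 : |deriv (fun s => ζ x s) y| ≤ Mt := hMt (x, y) ⟨hxc, hy⟩
        rw [Real.norm_eq_abs, abs_mul, abs_mul, abs_of_nonneg (hz0 y), abs_of_nonneg zero_le_two]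
        have := mul_le_mul (hzle y) h1 (abs_nonneg _) zero_le_one
        linarith
    rw [abs_of_nonneg hst] at hz
    have hPt : |ebP m l (v x t)| ≤ MP := hMP _ (h.v_nonneg hx htI)
    have hzs : max (ζ x s - ε) 0 ^ 2 ≤ 1 := pow_le_one₀ (hz0 s) (hzle s)
    unfold eD
    calc |ebP m l (v x s) * max (ζ x s - ε) 0 ^ 2 - ebP m l (v x t) * max (ζ x t - ε) 0 ^ 2|
        = |(ebP m l (v x s) - ebP m l (v x t)) * max (ζ x s - ε) 0 ^ 2
          + ebP m l (v x t) * (max (ζ x s - ε) 0 ^ 2 - max (ζ x t - ε) 0 ^ 2)| := by ring_nf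
      _ ≤ |ebP m l (v x s) - ebP m l (v x t)| * max (ζ x s - ε) 0 ^ 2
          + |ebP m l (v x t)| * |max (ζ x s - ε) 0 ^ 2 - max (ζ x t - ε) 0 ^ 2| := by
          refine (abs_add_le _ _).trans ?_
          rw [abs_mul, abs_mul, abs_of_nonneg (sq_nonneg (max (ζ x s - ε) 0))]
      _ ≤ (Mp * (N * (s - t))) * 1 + MP * ((2 * Mt) * (s - t)) := by
          gcongr
          exact hP.trans (by gcongr)
      _ = _ := by ring
  · have e1 : max (ζ x s - ε) 0 = 0 :=
      max_eq_right (by linarith [hr x hxc s (Ioc_subset_Icc_self hsI) hxr])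
    have e2 : max (ζ x t - ε) 0 = 0 :=
      max_eq_right (by linarith [hr x hxc t (Ioc_subset_Icc_self htI) hxr])
    unfold eD
    rw [e1, e2]
    simp only [ne_eq, OfNat.ofNat_ne_zero, not_false_eq_true, zero_pow, mul_zero, sub_self,
      abs_zero]
    positivity

lemma E_deriv (h : EbData d m ρ t₀ t₁ μ k l B v ζ) {ε : ℝ} (hε : 0 < ε) {t : ℝ}
    (ht : t ∈ Ioo t₀ t₁) :
    HasDerivWithinAt (fun t => ∫ x in Metric.ball 0 ρ, eD m l ε v ζ t x)
      (∫ x in Metric.ball 0 ρ, orig m l ε B v ζ t x) (Ioi t) t := by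
  obtain ⟨C, δ, hδ, hδt, HC⟩ := h.eD_lip hε ht
  rw [hasDerivWithinAt_iff_tendsto_slope' (by simp)]
  have hev : ∀ᶠ s in 𝓝[>] t, s ∈ Ioo t (t + δ) := Ioo_mem_nhdsGT (by linarith)
  have hI : ∀ s ∈ Icc t (t + δ), s ∈ Icc t₀ t₁ := fun s hs =>
    ⟨by linarith [ht.1, hs.1], by linarith [hs.2]⟩
  have htI : t ∈ Icc t₀ t₁ := Ioo_subset_Icc_self ht
  have key : Tendsto (fun s => ∫ x in Metric.ball 0 ρ, slope (fun s => eD m l ε v ζ s x) t s)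
      (𝓝[>] t) (𝓝 (∫ x in Metric.ball 0 ρ, orig m l ε B v ζ t x)) := by
    refine tendsto_integral_filter_of_dominated_convergence (fun _ => C) ?_ ?_ ?_ ?_
    · filter_upwards [hev] with s hs
      have hs' := hI s (Ioo_subset_Icc_self hs)
      simp only [slope, vsub_eq_sub]
      exact (((cont_int (h.eD_contx ε hs')).sub (cont_int (h.eD_contx ε htI))).smul
        (s - t)⁻¹).aestronglyMeasurable
    · filter_upwards [hev] with s hs
      filter_upwards [ae_restrict_mem measurableSet_ball] with x hx
      have h1 := HC x hx s (Ioo_subset_Icc_self hs)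
      have hpos : 0 < s - t := by linarith [hs.1]
      rw [slope_def_field, Real.norm_eq_abs, abs_div, abs_of_pos hpos, div_le_iff₀ hpos]
      exact h1
    · exact integrableOn_const (by exact measure_ball_lt_top.ne)
    · filter_upwards [ae_restrict_mem measurableSet_ball] with x hx
      exact (hasDerivWithinAt_iff_tendsto_slope' (by simp)).1
        ((h.eD_hasDerivAt ε ht hx).hasDerivWithinAt (s := Ioi t))
  refine key.congr' ?_
  filter_upwards [hev] with s hs
  have hs' := hI s (Ioo_subset_Icc_self hs)
  simp only [slope, vsub_eq_sub]
  rw [integral_smul, integral_sub (cont_int (h.eD_contx ε hs')) (cont_int (h.eD_contx ε htI))]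
end EbData

/-- the space-time measure -/
def ebM (d : ℕ) (ρ t₀ t₁ : ℝ) : Measure (Rd d × ℝ) :=
  (volume.restrict (Metric.ball (0 : Rd d) ρ)).prod (volume.restrict (Ioc t₀ t₁))

lemma ebM_eq (d : ℕ) (ρ t₀ t₁ : ℝ) :
    ebM d ρ t₀ t₁ = volume.restrict (Metric.ball (0 : Rd d) ρ ×ˢ Ioc t₀ t₁) :=
  Measure.prod_restrict _ _

lemma ebM_meas (d : ℕ) (ρ t₀ t₁ : ℝ) :
    MeasurableSet (Metric.ball (0 : Rd d) ρ ×ˢ Ioc t₀ t₁) :=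
  measurableSet_ball.prod measurableSet_Ioc

lemma ebM_ae (d : ℕ) (ρ t₀ t₁ : ℝ) :
    ∀ᵐ p ∂(ebM d ρ t₀ t₁), p ∈ Metric.ball (0 : Rd d) ρ ×ˢ Ioc t₀ t₁ := by
  rw [ebM_eq]; exact ae_restrict_mem (ebM_meas d ρ t₀ t₁)

lemma ebM_cont {d : ℕ} {ρ t₀ t₁ : ℝ} {E : Type*} [TopologicalSpace E]
    [TopologicalSpace.PseudoMetrizableSpace E] [SecondCountableTopology E]
    {f : Rd d × ℝ → E}
    (hf : ContinuousOn f (Metric.ball (0 : Rd d) ρ ×ˢ Ioc t₀ t₁)) :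
    AEStronglyMeasurable f (ebM d ρ t₀ t₁) := by
  rw [ebM_eq]; exact hf.aestronglyMeasurable (ebM_meas d ρ t₀ t₁)

lemma ebM_tmeas {d : ℕ} {ρ t₀ t₁ : ℝ} {F : ℝ → Rd d → ℝ}
    (hF : AEStronglyMeasurable (fun p : Rd d × ℝ => F p.2 p.1) (ebM d ρ t₀ t₁)) :
    AEStronglyMeasurable (fun t => ∫ x in Metric.ball 0 ρ, F t x) (volume.restrict (Ioc t₀ t₁)) :=
  hF.prod_swap.integral_prod_right'

namespace EbData
variable {d : ℕ} {m ρ t₀ t₁ μ k l : ℝ} {B : Rd d → ℝ → Rd d} {v ζ : Rd d → ℝ → ℝ}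

lemma vcont' (h : EbData d m ρ t₀ t₁ μ k l B v ζ) :
    ContinuousOn (fun p : Rd d × ℝ => v p.1 p.2) (Metric.ball (0 : Rd d) ρ ×ˢ Ioc t₀ t₁) :=
  h.vcont.mono (prod_mono Metric.ball_subset_closedBall Ioc_subset_Icc_self)

lemma Bcont' (h : EbData d m ρ t₀ t₁ μ k l B v ζ) :
    ContinuousOn (fun p : Rd d × ℝ => B p.1 p.2) (Metric.ball (0 : Rd d) ρ ×ˢ Ioc t₀ t₁) :=
  h.Bcont.mono (prod_mono Metric.ball_subset_closedBall Subset.rfl)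

lemma set_meas (h : EbData d m ρ t₀ t₁ μ k l B v ζ) :
    MeasurableSet ({p : Rd d × ℝ | l < v p.1 p.2} ∩ (Metric.ball (0 : Rd d) ρ ×ˢ Ioc t₀ t₁)) := by
  obtain ⟨u, hu, he⟩ := continuousOn_iff'.1 h.vcont' (Ioi l) isOpen_Ioi
  have : {p : Rd d × ℝ | l < v p.1 p.2} = (fun p : Rd d × ℝ => v p.1 p.2) ⁻¹' Ioi l := rfl
  rw [this, he]
  exact hu.measurableSet.inter (ebM_meas d ρ t₀ t₁)

lemma ind_meas (h : EbData d m ρ t₀ t₁ μ k l B v ζ) {g : Rd d × ℝ → ℝ}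
    (hg : AEStronglyMeasurable g (ebM d ρ t₀ t₁)) :
    AEStronglyMeasurable (fun p : Rd d × ℝ => {y | l < v y p.2}.indicator (fun y => g (y, p.2)) p.1)
      (ebM d ρ t₀ t₁) := by
  refine (hg.indicator h.set_meas).congr ?_
  filter_upwards [ebM_ae d ρ t₀ t₁] with p hp
  by_cases hl : l < v p.1 p.2
  · rw [indicator_of_mem (show p ∈ {p : Rd d × ℝ | l < v p.1 p.2} ∩ _ from ⟨hl, hp⟩),
      indicator_of_mem (show p.1 ∈ {y | l < v y p.2} from hl)]
  · rw [indicator_of_notMem (show p ∉ {p : Rd d × ℝ | l < v p.1 p.2} ∩ _ from fun hc => hl hc.1),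
      indicator_of_notMem (show p.1 ∉ {y | l < v y p.2} from hl)]

lemma fder_meas (h : EbData d m ρ t₀ t₁ μ k l B v ζ) :
    AEStronglyMeasurable (fun p : Rd d × ℝ => ‖fderiv ℝ (fun y => v y p.2) p.1‖ ^ 2)
      (ebM d ρ t₀ t₁) := by
  classical
  simp only [eb_norm_sq]
  have key : ∀ i : Fin d, AEMeasurable (fun p : Rd d × ℝ =>
      fderiv ℝ (fun y => v y p.2) p.1 (EuclideanSpace.single i 1)) (ebM d ρ t₀ t₁) := by
    intro i
    set S := Metric.ball (0 : Rd d) ρ ×ˢ Ioc t₀ t₁ with hS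
    set V : Rd d × ℝ → ℝ := S.piecewise (fun p => v p.1 p.2) (fun _ => 0) with hV
    have hVm : Measurable V :=
      ContinuousOn.measurable_piecewise h.vcont' continuousOn_const (ebM_meas d ρ t₀ t₁)
    have hVS : ∀ p ∈ S, V p = v p.1 p.2 := fun p hp => piecewise_eq_of_mem _ _ _ hp
    refine aemeasurable_of_tendsto_metrizable_ae atTop
      (f := fun (n : ℕ) (p : Rd d × ℝ) => ((n : ℝ) + 1) • (V (p.1 + ((n : ℝ) + 1)⁻¹ •
        EuclideanSpace.single i 1, p.2) - V p)) (fun n => ?_) ?_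
    · have h1 : Measurable (fun p : Rd d × ℝ =>
          V (p.1 + ((n : ℝ) + 1)⁻¹ • EuclideanSpace.single i 1, p.2)) :=
        hVm.comp (by fun_prop)
      exact ((h1.sub hVm).const_smul ((n : ℝ) + 1)).aemeasurable
    · filter_upwards [ebM_ae d ρ t₀ t₁] with p hp
      have hn := Metric.isOpen_ball.mem_nhds hp.1
      have hd : DifferentiableAt ℝ (fun y => v y p.2) p.1 :=
        ((h.vC2 p.2 hp.2).contDiffAt hn).differentiableAt (by norm_num)
      have hc : Tendsto (fun n : ℕ => ‖((n : ℝ) + 1)‖) atTop atTop := by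
        have : Tendsto (fun n : ℕ => ((n : ℝ) + 1)) atTop atTop :=
          tendsto_atTop_add_const_right _ _ tendsto_natCast_atTop_atTop
        exact tendsto_norm_atTop_atTop.comp this
      have hlim := hd.hasFDerivAt.lim (EuclideanSpace.single i 1) hc
      refine hlim.congr' ?_
      have hx : Tendsto (fun n : ℕ => p.1 + ((n : ℝ) + 1)⁻¹ • (EuclideanSpace.single i (1:ℝ) : Rd d))
          atTop (𝓝 p.1) := by
        have h1 : Tendsto (fun n : ℕ => ((n : ℝ) + 1)⁻¹) atTop (𝓝 0) := by
          simpa [one_div] using tendsto_one_div_add_atTop_nhds_zero_nat (𝕜 := ℝ)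
        simpa using (h1.smul_const (EuclideanSpace.single i (1:ℝ) : Rd d)).const_add p.1
      filter_upwards [hx.eventually hn] with n hn'
      rw [hVS p hp, hVS (_, p.2) ⟨hn', hp.2⟩]
  have h2 := Finset.aemeasurable_fun_sum (μ := ebM d ρ t₀ t₁) Finset.univ
    (fun i _ => (key i).pow_const 2)
  exact h2.aestronglyMeasurable

lemma ζcont' (h : EbData d m ρ t₀ t₁ μ k l B v ζ) : Continuous (fun p : Rd d × ℝ => ζ p.1 p.2) :=
  h.ζC.continuous

lemma hI_meas (h : EbData d m ρ t₀ t₁ μ k l B v ζ) (ε : ℝ) :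
    AEStronglyMeasurable (fun p : Rd d × ℝ => hI l ε v ζ p.2 p.1) (ebM d ρ t₀ t₁) :=
  h.ind_meas (g := fun p => ‖fderiv ℝ (fun y => v y p.2) p.1‖ ^ 2 * (max (ζ p.1 p.2 - ε) 0) ^ 2)
    (h.fder_meas.mul (ebM_cont (((h.ζcont'.sub continuous_const).sup continuous_const).pow
      2).continuousOn))

lemma gI_meas (h : EbData d m ρ t₀ t₁ μ k l B v ζ) :
    AEStronglyMeasurable (fun p : Rd d × ℝ => gI l v ζ p.2 p.1) (ebM d ρ t₀ t₁) :=
  h.ind_meas (g := fun p => ‖fderiv ℝ (fun y => ζ y p.2) p.1‖ ^ 2)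
    (ebM_cont h.ζdx_joint.continuousOn)

lemma tI_meas (h : EbData d m ρ t₀ t₁ μ k l B v ζ) :
    AEStronglyMeasurable (fun p : Rd d × ℝ => tI l v ζ p.2 p.1) (ebM d ρ t₀ t₁) :=
  h.ind_meas (g := fun p => |ζ p.1 p.2 * deriv (fun s => ζ p.1 s) p.2|)
    (ebM_cont ((h.ζcont'.mul h.ζdt_joint).abs).continuousOn)

lemma bI_meas (h : EbData d m ρ t₀ t₁ μ k l B v ζ) :
    AEStronglyMeasurable (fun p : Rd d × ℝ => bI l B v ζ p.2 p.1) (ebM d ρ t₀ t₁) := by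
  apply ebM_cont
  unfold bI
  exact (h.Bcont'.norm.pow 2).mul ((((h.vcont'.sub continuousOn_const).sup continuousOn_const).mul
    h.ζcont'.continuousOn).pow 2)

lemma bdd_tint {F : ℝ → Rd d → ℝ} {M : ℝ}
    (hF : AEStronglyMeasurable (fun p : Rd d × ℝ => F p.2 p.1) (ebM d ρ t₀ t₁))
    (hM : ∀ x ∈ Metric.ball (0 : Rd d) ρ, ∀ t ∈ Ioc t₀ t₁, ‖F t x‖ ≤ M) :
    IntegrableOn (fun t => ∫ x in Metric.ball 0 ρ, F t x) (Ioc t₀ t₁) := by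
  refine Integrable.of_bound (ebM_tmeas hF) (M * (volume.real (Metric.ball (0 : Rd d) ρ))) ?_
  filter_upwards [ae_restrict_mem measurableSet_Ioc] with t ht
  exact norm_setIntegral_le_of_norm_le_const measure_ball_lt_top fun x hx => hM x hx t ht

lemma ind_norm_le (S : Set (Rd d)) (g : Rd d → ℝ) (x : Rd d) {M : ℝ} (hM : ‖g x‖ ≤ M) :
    ‖S.indicator g x‖ ≤ M := (norm_indicator_le_norm_self g x).trans hM

lemma G_int (h : EbData d m ρ t₀ t₁ μ k l B v ζ) :
    IntegrableOn (fun t => ∫ x in Metric.ball 0 ρ, gI l v ζ t x) (Ioc t₀ t₁) := by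
  obtain ⟨M, hM⟩ := ((isCompact_closedBall (0 : Rd d) ρ).prod
    (isCompact_Icc (a := t₀) (b := t₁))).exists_bound_of_continuousOn h.ζdx_joint.continuousOn
  refine bdd_tint (M := M) h.gI_meas fun x hx t ht => ind_norm_le _ _ _ ?_
  exact hM (x, t) ⟨Metric.ball_subset_closedBall hx, Ioc_subset_Icc_self ht⟩

lemma T_int (h : EbData d m ρ t₀ t₁ μ k l B v ζ) :
    IntegrableOn (fun t => ∫ x in Metric.ball 0 ρ, tI l v ζ t x) (Ioc t₀ t₁) := by
  obtain ⟨M, hM⟩ := ((isCompact_closedBall (0 : Rd d) ρ).prod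
    (isCompact_Icc (a := t₀) (b := t₁))).exists_bound_of_continuousOn
      ((h.ζcont'.mul h.ζdt_joint).abs).continuousOn
  refine bdd_tint (M := M) h.tI_meas fun x hx t ht => ind_norm_le _ _ _ ?_
  exact hM (x, t) ⟨Metric.ball_subset_closedBall hx, Ioc_subset_Icc_self ht⟩

lemma hI_nonneg (ε t : ℝ) (x : Rd d) : 0 ≤ hI l ε v ζ t x :=
  indicator_nonneg (fun _ _ => by positivity) x

lemma gI_nonneg (t : ℝ) (x : Rd d) : 0 ≤ gI l v ζ t x :=
  indicator_nonneg (fun _ _ => by positivity) x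

lemma tI_nonneg (t : ℝ) (x : Rd d) : 0 ≤ tI l v ζ t x :=
  indicator_nonneg (fun _ _ => by positivity) x

lemma bI_nonneg (t : ℝ) (x : Rd d) : 0 ≤ bI l B v ζ t x := by
  unfold bI; positivity

/-- right-hand side density -/
def Rt (m ρ k l : ℝ) (B : Rd d → ℝ → Rd d) (v ζ : Rd d → ℝ → ℝ) (t : ℝ) : ℝ :=
  5 / 2 * k ^ 2 * (∫ x in Metric.ball 0 ρ, gI l v ζ t x)
        + 1 / 2 * (l ^ (-((m - 1) / m))) ^ 2 * (∫ x in Metric.ball 0 ρ, bI l B v ζ t x)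
        + l ^ (-((m - 1) / m)) * k ^ 2 * (∫ x in Metric.ball 0 ρ, tI l v ζ t x)

lemma Rt_nonneg (h : EbData d m ρ t₀ t₁ μ k l B v ζ) (t : ℝ) : 0 ≤ Rt m ρ k l B v ζ t := by
  have h1 : 0 ≤ ∫ x in Metric.ball 0 ρ, gI l v ζ t x := integral_nonneg fun x => gI_nonneg t x
  have h2 : 0 ≤ ∫ x in Metric.ball 0 ρ, bI l B v ζ t x := integral_nonneg fun x => bI_nonneg t x
  have h3 : 0 ≤ ∫ x in Metric.ball 0 ρ, tI l v ζ t x := integral_nonneg fun x => tI_nonneg t x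
  have h4 : 0 ≤ l ^ (-((m - 1) / m)) := Real.rpow_nonneg h.hl.le _
  unfold Rt
  positivity

lemma Rt_int (h : EbData d m ρ t₀ t₁ μ k l B v ζ)
    (hb : IntegrableOn (fun t => ∫ x in Metric.ball 0 ρ, bI l B v ζ t x) (Ioc t₀ t₁)) :
    IntegrableOn (Rt m ρ k l B v ζ) (Ioc t₀ t₁) :=
  ((h.G_int.const_mul _).add (hb.const_mul _)).add (h.T_int.const_mul _)

lemma time_int (h : EbData d m ρ t₀ t₁ μ k l B v ζ)
    (hb : IntegrableOn (fun t => ∫ x in Metric.ball 0 ρ, bI l B v ζ t x) (Ioc t₀ t₁))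
    {ε : ℝ} (hε : 0 < ε) {N : ℝ} (hN : 0 ≤ N) {s : ℝ} (hs : s ∈ Icc t₀ t₁) :
    (∫ x in Metric.ball 0 ρ, eD m l ε v ζ s x)
      + 1 / 2 * (∫ t in Ioc t₀ s, min (∫ x in Metric.ball 0 ρ, hI l ε v ζ t x) N)
      ≤ ∫ t in Ioc t₀ t₁, Rt m ρ k l B v ζ t := by
  have hsub : Ioc t₀ s ⊆ Ioc t₀ t₁ := Ioc_subset_Ioc_right hs.2
  have hmin : IntegrableOn (fun t => min (∫ x in Metric.ball 0 ρ, hI l ε v ζ t x) N)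
      (Ioc t₀ t₁) := by
    refine Integrable.of_bound ((ebM_tmeas (h.hI_meas ε)).inf aestronglyMeasurable_const) N ?_
    refine Eventually.of_forall fun t => ?_
    have h0 : 0 ≤ ∫ x in Metric.ball 0 ρ, hI l ε v ζ t x := integral_nonneg fun x => hI_nonneg _ _ _
    rw [Real.norm_eq_abs, abs_of_nonneg (le_min h0 hN)]
    exact min_le_right _ _
  have hR := h.Rt_int hb
  have hφ : IntegrableOn (fun t => Rt m ρ k l B v ζ t
      - 1 / 2 * min (∫ x in Metric.ball 0 ρ, hI l ε v ζ t x) N) (Ioc t₀ s) :=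
    (hR.mono_set hsub).sub ((hmin.mono_set hsub).const_mul _)
  have main := intervalIntegral.sub_le_integral_of_hasDeriv_right_of_le hs.1
    ((h.E_cont ε).mono (Icc_subset_Icc_right hs.2))
    (fun t ht => h.E_deriv hε ⟨ht.1, lt_of_lt_of_le ht.2 hs.2⟩)
    ((integrableOn_Icc_iff_integrableOn_Ioc (by simp)).2 hφ) (fun t ht => by
      have h1 := h.fixed_time hε (t := t) ⟨ht.1, ht.2.le.trans hs.2⟩
      have h2 := min_le_left (∫ x in Metric.ball 0 ρ, hI l ε v ζ t x) N
      unfold Rt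
      linarith)
  have hE0 : ∫ x in Metric.ball 0 ρ, eD m l ε v ζ t₀ x = 0 := by
    refine setIntegral_eq_zero_of_forall_eq_zero fun x hx => ?_
    unfold eD
    rw [h.ζi x (Metric.ball_subset_closedBall hx), max_eq_right (by linarith)]
    simp
  rw [hE0, intervalIntegral.integral_of_le hs.1, integral_sub (hR.mono_set hsub)
    ((hmin.mono_set hsub).const_mul _), integral_const_mul] at main
  have hmono : ∫ t in Ioc t₀ s, Rt m ρ k l B v ζ t ≤ ∫ t in Ioc t₀ t₁, Rt m ρ k l B v ζ t :=
    setIntegral_mono_set hR (Eventually.of_forall fun t => h.Rt_nonneg t) hsub.eventuallyLE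
  linarith
end EbData

lemma eb_fatou {α : Type*} [MeasurableSpace α] {ν : Measure α} {f : ℕ → α → ℝ≥0∞} {F : α → ℝ≥0∞}
    {c : ℝ≥0∞} (hm : ∀ n, AEMeasurable (f n) ν)
    (ht : ∀ᵐ a ∂ν, Tendsto (fun n => f n a) atTop (𝓝 (F a))) (hc : ∀ n, ∫⁻ a, f n a ∂ν ≤ c) :
    ∫⁻ a, F a ∂ν ≤ c := by
  calc ∫⁻ a, F a ∂ν = ∫⁻ a, liminf (fun n => f n a) atTop ∂ν :=
        lintegral_congr_ae (by filter_upwards [ht] with a ha using ha.liminf_eq.symm)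
    _ ≤ liminf (fun n => ∫⁻ a, f n a ∂ν) atTop := lintegral_liminf_le' hm
    _ ≤ limsup (fun n => ∫⁻ a, f n a ∂ν) atTop := liminf_le_limsup
    _ ≤ c := limsup_le_of_le (by isBoundedDefault) (Eventually.of_forall hc)

lemma eb_ofReal_integral_le {α : Type*} [MeasurableSpace α] {ν : Measure α} {f : α → ℝ}
    (hf : 0 ≤ᵐ[ν] f) : ENNReal.ofReal (∫ a, f a ∂ν) ≤ ∫⁻ a, ENNReal.ofReal (f a) ∂ν := by
  by_cases hi : Integrable f ν
  · rw [ofReal_integral_eq_lintegral_ofReal hi hf]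
  · rw [integral_undef hi]; simp

namespace EbData
variable {d : ℕ} {m ρ t₀ t₁ μ k l : ℝ} {B : Rd d → ℝ → Rd d} {v ζ : Rd d → ℝ → ℝ}

lemma hn_nonneg (ε t : ℝ) : 0 ≤ ∫ x in Metric.ball 0 ρ, hI l ε v ζ t x :=
  integral_nonneg fun _ => hI_nonneg _ _ _

lemma min_int (h : EbData d m ρ t₀ t₁ μ k l B v ζ) (ε : ℝ) {N : ℝ} (hN : 0 ≤ N) :
    IntegrableOn (fun t => min (∫ x in Metric.ball 0 ρ, hI l ε v ζ t x) N) (Ioc t₀ t₁) := by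
  refine Integrable.of_bound ((ebM_tmeas (h.hI_meas ε)).inf aestronglyMeasurable_const) N ?_
  refine Eventually.of_forall fun t => ?_
  rw [Real.norm_eq_abs, abs_of_nonneg (le_min (hn_nonneg ε t) hN)]
  exact min_le_right _ _

lemma eD_nonneg (h : EbData d m ρ t₀ t₁ μ k l B v ζ) (ε s : ℝ) (x : Rd d) :
    0 ≤ eD m l ε v ζ s x := mul_nonneg (ebP_nonneg h.hm h.hl _) (sq_nonneg _)

lemma eps_tendsto (a : ℝ) :
    Tendsto (fun n : ℕ => max (a - 1 / ((n : ℝ) + 1)) 0) atTop (𝓝 (max (a - 0) 0)) :=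
  (tendsto_const_nhds.sub tendsto_one_div_add_atTop_nhds_zero_nat).max tendsto_const_nhds

lemma E0_le (h : EbData d m ρ t₀ t₁ μ k l B v ζ)
    (hb : IntegrableOn (fun t => ∫ x in Metric.ball 0 ρ, bI l B v ζ t x) (Ioc t₀ t₁))
    {s : ℝ} (hs : s ∈ Icc t₀ t₁) :
    ∫ x in Metric.ball 0 ρ, eD m l 0 v ζ s x ≤ ∫ t in Ioc t₀ t₁, Rt m ρ k l B v ζ t := by
  have hle : ∀ n : ℕ, ∫ x in Metric.ball 0 ρ, eD m l (1 / ((n : ℝ) + 1)) v ζ s x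
      ≤ ∫ t in Ioc t₀ t₁, Rt m ρ k l B v ζ t := by
    intro n
    have h1 := h.time_int hb (ε := 1 / ((n : ℝ) + 1)) (by positivity) (N := 0) le_rfl hs
    have h2 : 0 ≤ ∫ t in Ioc t₀ s,
        min (∫ x in Metric.ball 0 ρ, hI l (1 / ((n : ℝ) + 1)) v ζ t x) 0 :=
      integral_nonneg fun t => le_min (hn_nonneg _ t) le_rfl
    linarith
  have hlim : Tendsto (fun n : ℕ => ∫ x in Metric.ball 0 ρ, eD m l (1 / ((n : ℝ) + 1)) v ζ s x)
      atTop (𝓝 (∫ x in Metric.ball 0 ρ, eD m l 0 v ζ s x)) := by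
    refine tendsto_integral_of_dominated_convergence (fun x => ebP m l (v x s)) ?_ ?_ ?_ ?_
    · intro n
      exact (cont_int (h.eD_contx _ hs)).aestronglyMeasurable
    · exact cont_int ((ebP_contDiff (m := m) h.hl).continuous.comp_continuousOn (h.vcx hs))
    · intro n
      refine Eventually.of_forall fun x => ?_
      rw [Real.norm_eq_abs, abs_of_nonneg (h.eD_nonneg _ _ _)]
      unfold eD
      refine mul_le_of_le_one_right (ebP_nonneg h.hm h.hl _) (pow_le_one₀ (le_max_right _ _) ?_)
      have : (0:ℝ) ≤ 1 / ((n : ℝ) + 1) := by positivity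
      exact max_le (by linarith [h.ζ1 x s]) zero_le_one
    · refine Eventually.of_forall fun x => ?_
      exact ((eps_tendsto (ζ x s)).pow 2).const_mul _
  exact le_of_tendsto' hlim hle

lemma sup_term (h : EbData d m ρ t₀ t₁ μ k l B v ζ)
    (hb : IntegrableOn (fun t => ∫ x in Metric.ball 0 ρ, bI l B v ζ t x) (Ioc t₀ t₁))
    {s : ℝ} (hs : s ∈ Icc t₀ t₁) :
    μ ^ (-((m - 1) / m)) * (∫ x in Metric.ball 0 ρ, (max (v x s - l) 0) ^ 2 * (ζ x s) ^ 2)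
      ≤ 2 * m * ∫ t in Ioc t₀ t₁, Rt m ρ k l B v ζ t := by
  have h1 := h.E0_le hb hs
  have hm : 0 < m := by linarith [h.hm]
  have hc : ContinuousOn (fun x => (max (v x s - l) 0) ^ 2 * (ζ x s) ^ 2)
      (Metric.closedBall 0 ρ) :=
    ((((h.vcx hs).sub continuousOn_const).sup continuousOn_const).pow 2).mul
      ((h.ζc s).continuousOn.pow 2)
  have h2 : (1 / (2 * m) * μ ^ (-((m - 1) / m))) *
      (∫ x in Metric.ball 0 ρ, (max (v x s - l) 0) ^ 2 * (ζ x s) ^ 2)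
      ≤ ∫ x in Metric.ball 0 ρ, eD m l 0 v ζ s x := by
    rw [← integral_const_mul]
    refine setIntegral_mono_on ((cont_int hc).const_mul _) (cont_int (h.eD_contx 0 hs))
      measurableSet_ball fun x hx => ?_
    have h3 := ebP_lower h.hm h.hl (h.vle x (Metric.ball_subset_closedBall hx) s hs)
    unfold eD
    rw [sub_zero, max_eq_left (h.ζ0 x s)]
    have := mul_le_mul_of_nonneg_right h3 (sq_nonneg (ζ x s))
    linarith
  have h4 := h2.trans h1
  have h5 := mul_le_mul_of_nonneg_left h4 (by positivity : 0 ≤ 2 * m)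
  refine le_trans (le_of_eq ?_) h5
  field_simp

lemma h_lint (h : EbData d m ρ t₀ t₁ μ k l B v ζ)
    (hb : IntegrableOn (fun t => ∫ x in Metric.ball 0 ρ, bI l B v ζ t x) (Ioc t₀ t₁))
    {ε : ℝ} (hε : 0 < ε) :
    ∫⁻ p, ENNReal.ofReal (hI l ε v ζ p.2 p.1) ∂(ebM d ρ t₀ t₁)
      ≤ ENNReal.ofReal (2 * ∫ t in Ioc t₀ t₁, Rt m ρ k l B v ζ t) := by
  have h1 : ∫⁻ p, ENNReal.ofReal (hI l ε v ζ p.2 p.1) ∂(ebM d ρ t₀ t₁)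
      = ∫⁻ t in Ioc t₀ t₁, ∫⁻ x in Metric.ball 0 ρ, ENNReal.ofReal (hI l ε v ζ t x) :=
    lintegral_prod_symm _ (h.hI_meas ε).aemeasurable.ennreal_ofReal
  have h2 : ∫⁻ t in Ioc t₀ t₁, ∫⁻ x in Metric.ball 0 ρ, ENNReal.ofReal (hI l ε v ζ t x)
      = ∫⁻ t in Ioc t₀ t₁, ENNReal.ofReal (∫ x in Metric.ball 0 ρ, hI l ε v ζ t x) := by
    refine setLIntegral_congr_fun measurableSet_Ioc fun t ht => ?_
    exact (ofReal_integral_eq_lintegral_ofReal (h.hI_int hε ht)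
      (Eventually.of_forall fun x => hI_nonneg _ _ _)).symm
  rw [h1, h2]
  refine eb_fatou (f := fun (n : ℕ) t =>
    ENNReal.ofReal (min (∫ x in Metric.ball 0 ρ, hI l ε v ζ t x) n)) (fun n => ?_) ?_ fun n => ?_
  · exact (h.min_int ε (Nat.cast_nonneg n)).aestronglyMeasurable.aemeasurable.ennreal_ofReal
  · refine Eventually.of_forall fun t => ?_
    refine ENNReal.tendsto_ofReal ?_
    refine tendsto_const_nhds.congr' ?_
    obtain ⟨n0, hn0⟩ := exists_nat_ge (∫ x in Metric.ball 0 ρ, hI l ε v ζ t x)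
    filter_upwards [eventually_ge_atTop n0] with n hn
    rw [min_eq_left (hn0.trans (by exact_mod_cast hn))]
  · rw [← ofReal_integral_eq_lintegral_ofReal (h.min_int ε (Nat.cast_nonneg n))
      (Eventually.of_forall fun t => le_min (hn_nonneg ε t) (Nat.cast_nonneg n))]
    apply ENNReal.ofReal_le_ofReal
    have h3 := h.time_int hb hε (N := n) (Nat.cast_nonneg n) (right_mem_Icc.2 h.ht.le)
    have h4 : 0 ≤ ∫ x in Metric.ball 0 ρ, eD m l ε v ζ t₁ x :=
      integral_nonneg fun x => h.eD_nonneg _ _ _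
    linarith

lemma h0_lint (h : EbData d m ρ t₀ t₁ μ k l B v ζ)
    (hb : IntegrableOn (fun t => ∫ x in Metric.ball 0 ρ, bI l B v ζ t x) (Ioc t₀ t₁)) :
    ∫⁻ p, ENNReal.ofReal (hI l 0 v ζ p.2 p.1) ∂(ebM d ρ t₀ t₁)
      ≤ ENNReal.ofReal (2 * ∫ t in Ioc t₀ t₁, Rt m ρ k l B v ζ t) := by
  refine eb_fatou (f := fun (n : ℕ) p => ENNReal.ofReal (hI l (1 / ((n : ℝ) + 1)) v ζ p.2 p.1))
    (fun n => (h.hI_meas _).aemeasurable.ennreal_ofReal) ?_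
    fun n => h.h_lint hb (by positivity)
  refine Eventually.of_forall fun p => ENNReal.tendsto_ofReal ?_
  unfold hI
  by_cases hl : l < v p.1 p.2
  · have hm : p.1 ∈ {y | l < v y p.2} := hl
    simp only [indicator_of_mem hm]
    exact ((eps_tendsto (ζ p.1 p.2)).pow 2).const_mul _
  · have hm : p.1 ∉ {y | l < v y p.2} := hl
    simp only [indicator_of_notMem hm]
    exact tendsto_const_nhds

lemma grad_pt (h : EbData d m ρ t₀ t₁ μ k l B v ζ) {t : ℝ} (ht : t ∈ Ioc t₀ t₁) {x : Rd d}
    (hx : x ∈ Metric.ball (0 : Rd d) ρ) :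
    ‖fderiv ℝ (fun y => max (v y t - l) 0 * ζ y t) x‖ ^ 2
      ≤ 2 * hI l 0 v ζ t x + 2 * k ^ 2 * gI l v ζ t x := by
  have hn := Metric.isOpen_ball.mem_nhds hx
  have hζd : DifferentiableAt ℝ (fun y => ζ y t) x := ((h.ζx t).differentiable (by norm_num)) x
  by_cases hl : l < v x t
  · have hm : x ∈ {y | l < v y t} := hl
    have hvd : DifferentiableAt ℝ (fun y => v y t) x :=
      ((h.vC2 t ht).contDiffAt hn).differentiableAt (by norm_num)
    have hev : (fun y => max (v y t - l) 0 * ζ y t) =ᶠ[𝓝 x] fun y => (v y t - l) * ζ y t := by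
      filter_upwards [hvd.continuousAt.eventually (lt_mem_nhds hl)] with y hy
      rw [max_eq_left (by linarith)]
    have hfd := ((hvd.hasFDerivAt.sub_const l).mul hζd.hasFDerivAt).fderiv
    have hfd' : fderiv ℝ (fun y => (v y t - l) * ζ y t) x
        = (v x t - l) • fderiv ℝ (fun y => ζ y t) x + ζ x t • fderiv ℝ (fun y => v y t) x := hfd
    rw [hev.fderiv_eq, hfd']
    unfold hI gI
    simp only [indicator_of_mem hm]
    rw [sub_zero, max_eq_left (h.ζ0 x t)]
    have hle := h.vle x (Metric.ball_subset_closedBall hx) t (Ioc_subset_Icc_self ht)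
    have hlk := h.hlk
    have hn1 : ‖(v x t - l) • fderiv ℝ (fun y => ζ y t) x + ζ x t • fderiv ℝ (fun y => v y t) x‖
        ≤ k * ‖fderiv ℝ (fun y => ζ y t) x‖ + ζ x t * ‖fderiv ℝ (fun y => v y t) x‖ := by
      refine (norm_add_le _ _).trans ?_
      rw [norm_smul, norm_smul, Real.norm_eq_abs, Real.norm_eq_abs, abs_of_nonneg (h.ζ0 x t),
        abs_of_nonneg (by linarith : 0 ≤ v x t - l)]
      gcongr
      linarith
    have hn2 := pow_le_pow_left₀ (norm_nonneg _) hn1 2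
    nlinarith [sq_nonneg (k * ‖fderiv ℝ (fun y => ζ y t) x‖
      - ζ x t * ‖fderiv ℝ (fun y => v y t) x‖)]
  · have hmin : IsLocalMin (fun y => max (v y t - l) 0 * ζ y t) x := by
      refine Eventually.of_forall fun y => ?_
      show max (v x t - l) 0 * ζ x t ≤ max (v y t - l) 0 * ζ y t
      rw [max_eq_right (by linarith : v x t - l ≤ 0), zero_mul]
      exact mul_nonneg (le_max_right _ _) (h.ζ0 y t)
    rw [hmin.fderiv_eq_zero]
    have h1 : 0 ≤ hI l 0 v ζ t x := hI_nonneg _ _ _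
    have h2 : 0 ≤ gI l v ζ t x := gI_nonneg _ _
    rw [norm_zero, zero_pow two_ne_zero]
    positivity

lemma grad_term (h : EbData d m ρ t₀ t₁ μ k l B v ζ)
    (hb : IntegrableOn (fun t => ∫ x in Metric.ball 0 ρ, bI l B v ζ t x) (Ioc t₀ t₁)) :
    ∫ t in Ioc t₀ t₁, ∫ x in Metric.ball 0 ρ,
        ‖fderiv ℝ (fun y => max (v y t - l) 0 * ζ y t) x‖ ^ 2
      ≤ 4 * (∫ t in Ioc t₀ t₁, Rt m ρ k l B v ζ t)
        + 2 * k ^ 2 * ∫ t in Ioc t₀ t₁, ∫ x in Metric.ball 0 ρ, gI l v ζ t x := by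
  have hR0 : 0 ≤ ∫ t in Ioc t₀ t₁, Rt m ρ k l B v ζ t := integral_nonneg fun t => h.Rt_nonneg t
  have hG0 : ∀ t, 0 ≤ ∫ x in Metric.ball 0 ρ, gI l v ζ t x := fun t =>
    integral_nonneg fun x => gI_nonneg _ _
  have hG00 : 0 ≤ ∫ t in Ioc t₀ t₁, ∫ x in Metric.ball 0 ρ, gI l v ζ t x :=
    integral_nonneg hG0
  rw [← ENNReal.ofReal_le_ofReal_iff (by positivity)]
  have hg : ∫⁻ p, ENNReal.ofReal (gI l v ζ p.2 p.1) ∂(ebM d ρ t₀ t₁)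
      = ENNReal.ofReal (∫ t in Ioc t₀ t₁, ∫ x in Metric.ball 0 ρ, gI l v ζ t x) := by
    have h1 : ∫⁻ p, ENNReal.ofReal (gI l v ζ p.2 p.1) ∂(ebM d ρ t₀ t₁)
        = ∫⁻ t in Ioc t₀ t₁, ∫⁻ x in Metric.ball 0 ρ, ENNReal.ofReal (gI l v ζ t x) :=
      lintegral_prod_symm _ h.gI_meas.aemeasurable.ennreal_ofReal
    rw [h1, ofReal_integral_eq_lintegral_ofReal h.G_int (Eventually.of_forall hG0)]
    refine setLIntegral_congr_fun measurableSet_Ioc fun t ht => ?_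
    exact (ofReal_integral_eq_lintegral_ofReal (h.gI_int (Ioc_subset_Icc_self ht))
      (Eventually.of_forall fun x => gI_nonneg _ _)).symm
  have hm1 : AEMeasurable (fun p : Rd d × ℝ => ENNReal.ofReal (hI l 0 v ζ p.2 p.1))
    (ebM d ρ t₀ t₁) := (h.hI_meas 0).aemeasurable.ennreal_ofReal
  have hm2 : AEMeasurable (fun p : Rd d × ℝ => ENNReal.ofReal (gI l v ζ p.2 p.1))
    (ebM d ρ t₀ t₁) := h.gI_meas.aemeasurable.ennreal_ofReal
  calc ENNReal.ofReal (∫ t in Ioc t₀ t₁, ∫ x in Metric.ball 0 ρ,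
        ‖fderiv ℝ (fun y => max (v y t - l) 0 * ζ y t) x‖ ^ 2)
      ≤ ∫⁻ t in Ioc t₀ t₁, ENNReal.ofReal (∫ x in Metric.ball 0 ρ,
        ‖fderiv ℝ (fun y => max (v y t - l) 0 * ζ y t) x‖ ^ 2) :=
        eb_ofReal_integral_le (Eventually.of_forall fun t => integral_nonneg fun x => by
          show (0:ℝ) ≤ _
          positivity)
    _ ≤ ∫⁻ t in Ioc t₀ t₁, ∫⁻ x in Metric.ball 0 ρ,
          ENNReal.ofReal 2 * ENNReal.ofReal (hI l 0 v ζ t x)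
            + ENNReal.ofReal (2 * k ^ 2) * ENNReal.ofReal (gI l v ζ t x) := by
        refine setLIntegral_mono' measurableSet_Ioc fun t ht => ?_
        refine (eb_ofReal_integral_le (Eventually.of_forall fun x => by
          show (0:ℝ) ≤ _
          positivity)).trans ?_
        refine setLIntegral_mono' measurableSet_ball fun x hx => ?_
        have h1 : 0 ≤ hI l 0 v ζ t x := hI_nonneg _ _ _
        have h2 : 0 ≤ gI l v ζ t x := gI_nonneg _ _
        rw [← ENNReal.ofReal_mul (by norm_num), ← ENNReal.ofReal_mul (by positivity),
          ← ENNReal.ofReal_add (by positivity) (by positivity)]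
        exact ENNReal.ofReal_le_ofReal (h.grad_pt ht hx)
    _ = ∫⁻ p, ENNReal.ofReal 2 * ENNReal.ofReal (hI l 0 v ζ p.2 p.1)
            + ENNReal.ofReal (2 * k ^ 2) * ENNReal.ofReal (gI l v ζ p.2 p.1) ∂(ebM d ρ t₀ t₁) :=
        (lintegral_prod_symm _ ((hm1.const_mul _).add (hm2.const_mul _))).symm
    _ = ENNReal.ofReal 2 * ∫⁻ p, ENNReal.ofReal (hI l 0 v ζ p.2 p.1) ∂(ebM d ρ t₀ t₁)
          + ENNReal.ofReal (2 * k ^ 2)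
            * ∫⁻ p, ENNReal.ofReal (gI l v ζ p.2 p.1) ∂(ebM d ρ t₀ t₁) := by
        rw [lintegral_add_left' (hm1.const_mul _), lintegral_const_mul'' _ hm1,
          lintegral_const_mul'' _ hm2]
    _ ≤ ENNReal.ofReal 2 * ENNReal.ofReal (2 * ∫ t in Ioc t₀ t₁, Rt m ρ k l B v ζ t)
          + ENNReal.ofReal (2 * k ^ 2)
            * ENNReal.ofReal (∫ t in Ioc t₀ t₁, ∫ x in Metric.ball 0 ρ, gI l v ζ t x) := by
        rw [hg]
        gcongr
        exact h.h0_lint hb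
    _ = _ := by
        rw [← ENNReal.ofReal_mul (by norm_num), ← ENNReal.ofReal_mul (by positivity),
          ← ENNReal.ofReal_add (by positivity) (by positivity)]
        congr 1; ring

lemma Rt_eq (h : EbData d m ρ t₀ t₁ μ k l B v ζ)
    (hb : IntegrableOn (fun t => ∫ x in Metric.ball 0 ρ, bI l B v ζ t x) (Ioc t₀ t₁)) :
    ∫ t in Ioc t₀ t₁, Rt m ρ k l B v ζ t
      = 5 / 2 * k ^ 2 * (∫ t in Ioc t₀ t₁, ∫ x in Metric.ball 0 ρ, gI l v ζ t x)
        + 1 / 2 * (l ^ (-((m - 1) / m))) ^ 2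
          * (∫ t in Ioc t₀ t₁, ∫ x in Metric.ball 0 ρ, bI l B v ζ t x)
        + l ^ (-((m - 1) / m)) * k ^ 2
          * (∫ t in Ioc t₀ t₁, ∫ x in Metric.ball 0 ρ, tI l v ζ t x) := by
  have i1 := h.G_int.const_mul (5 / 2 * k ^ 2)
  have i2 := hb.const_mul (1 / 2 * (l ^ (-((m - 1) / m))) ^ 2)
  have i3 := h.T_int.const_mul (l ^ (-((m - 1) / m)) * k ^ 2)
  have e1 := integral_add' (i1.add i2) i3
  have e2 := integral_add' i1 i2
  simp only [integral_const_mul] at e1 e2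
  rw [e2] at e1
  rw [← e1]
  rfl
end EbData

lemma eb_eLp2 {α E : Type*} [MeasurableSpace α] [NormedAddCommGroup E] (μ : Measure α) (f : α → E) :
    (eLpNorm f 2 μ) ^ 2 = ∫⁻ x, ‖f x‖ₑ ^ 2 ∂μ := by
  rw [eLpNorm_eq_lintegral_rpow_enorm_toReal (by norm_num) (by norm_num)]
  rw [← ENNReal.rpow_natCast, ← ENNReal.rpow_mul]
  simp

lemma eb_holder_exp (q : ℝ≥0∞) (hq : 1 < q) :
    ENNReal.HolderTriple (2 * q) (ENNReal.ofReal (qdual q 0)) 2 := by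
  constructor
  by_cases h : q = ∞
  · subst h
    simp [qdual]
  · have hq1 : 1 < q.toReal := by
      rw [← ENNReal.toReal_one]
      exact (ENNReal.toReal_lt_toReal (by simp) h).2 hq
    have hpos : 0 < 2 * q.toReal * (1 + 0) / (q.toReal - 1) := by
      apply div_pos <;> linarith
    have e2 : (2 : ℝ≥0∞) = ENNReal.ofReal 2 := by simp
    rw [qdual, if_neg h]
    nth_rewrite 1 [← ENNReal.ofReal_toReal h]
    rw [e2, ← ENNReal.ofReal_mul (by norm_num), ← ENNReal.ofReal_inv_of_pos (by linarith),
      ← ENNReal.ofReal_inv_of_pos hpos, ← ENNReal.ofReal_inv_of_pos (by norm_num),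
      ← ENNReal.ofReal_add (by positivity) (by positivity)]
    congr 1
    have : q.toReal - 1 ≠ 0 := by linarith
    field_simp
    ring

lemma eb_inner_meas {d : ℕ} {ρ t₀ t₁ : ℝ} {E : Type*} [NormedAddCommGroup E]
    (f : Rd d → ℝ → E) (q : ℝ≥0∞) (hq0 : q ≠ 0) (hq : q ≠ ∞)
    (hf : AEStronglyMeasurable (fun p : Rd d × ℝ => f p.1 p.2) (ebM d ρ t₀ t₁)) :
    AEMeasurable (fun t => eLpNorm (fun x => f x t) q (volume.restrict (Metric.ball 0 ρ)))
      (volume.restrict (Ioc t₀ t₁)) := by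
  simp only [eLpNorm_eq_lintegral_rpow_enorm_toReal hq0 hq]
  refine AEMeasurable.pow_const ?_ _
  have := hf.prod_swap.enorm.pow_const q.toReal
  exact this.lintegral_prod_right'

lemma eb_inner_fin {d : ℕ} {ρ : ℝ} {E : Type*} [NormedAddCommGroup E]
    (f : Rd d → E) (q : ℝ≥0∞)
    (hf : ContinuousOn f (Metric.closedBall 0 ρ)) :
    eLpNorm f q (volume.restrict (Metric.ball 0 ρ)) ≠ ∞ := by
  obtain ⟨C, hC⟩ := (isCompact_closedBall (0 : Rd d) ρ).exists_bound_of_continuousOn hf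
  haveI : IsFiniteMeasure (volume.restrict (Metric.ball (0 : Rd d) ρ)) :=
    ⟨by simpa using measure_ball_lt_top⟩
  have h1 : ∀ᵐ x ∂(volume.restrict (Metric.ball (0 : Rd d) ρ)), ‖f x‖ ≤ C := by
    filter_upwards [ae_restrict_mem measurableSet_ball] with x hx
    exact hC x (Metric.ball_subset_closedBall hx)
  refine ne_top_of_le_ne_top ?_ (eLpNorm_le_of_ae_bound h1)
  refine ENNReal.mul_ne_top (ENNReal.rpow_ne_top_of_nonneg (by positivity) (measure_ne_top _ _))
    ENNReal.ofReal_ne_top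

lemma eb_mixed {d : ℕ} {ρ t₀ t₁ : ℝ} (B : Rd d → ℝ → Rd d) (w : Rd d → ℝ → ℝ)
    (q1 q2 : ℝ≥0∞) (h1 : 1 < q1) (h2 : 1 < q2) (h2' : q2 < ∞)
    (hB : AEStronglyMeasurable (fun p : Rd d × ℝ => B p.1 p.2) (ebM d ρ t₀ t₁))
    (hw : AEStronglyMeasurable (fun p : Rd d × ℝ => w p.1 p.2) (ebM d ρ t₀ t₁))
    (hBc : ∀ t ∈ Ioc t₀ t₁, ContinuousOn (fun x => B x t) (Metric.closedBall 0 ρ))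
    (hwc : ∀ t ∈ Ioc t₀ t₁, ContinuousOn (fun x => w x t) (Metric.closedBall 0 ρ)) :
    ∫⁻ t in Ioc t₀ t₁, ∫⁻ x in Metric.ball 0 ρ, ENNReal.ofReal (‖B x t‖ ^ 2 * (w x t) ^ 2)
      ≤ (mixedNorm (2 * q1) (2 * q2) B (Metric.ball 0 ρ) (Ioc t₀ t₁)) ^ 2
        * (mixedNorm (ENNReal.ofReal (qdual q1 0)) (ENNReal.ofReal (qdual q2 0)) w
            (Metric.ball 0 ρ) (Ioc t₀ t₁)) ^ 2 := by
  haveI := eb_holder_exp q1 h1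
  haveI := eb_holder_exp q2 h2
  have hq2 : 1 < q2.toReal := by
    rw [← ENNReal.toReal_one]
    exact (ENNReal.toReal_lt_toReal (by simp) h2'.ne).2 h2
  have hd0 : 0 < qdual q2 0 := by
    rw [qdual, if_neg h2'.ne]
    apply div_pos <;> linarith
  set β := fun t => (eLpNorm (fun x => B x t) (2 * q2) (volume.restrict (Metric.ball 0 ρ))).toReal
    with hβ
  set ω := fun t => (eLpNorm (fun x => w x t) (ENNReal.ofReal (qdual q2 0))
    (volume.restrict (Metric.ball 0 ρ))).toReal with hω
  have hβm : AEStronglyMeasurable β (volume.restrict (Ioc t₀ t₁)) :=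
    (eb_inner_meas B (2 * q2) (by simp; rintro rfl; simp at h2)
      (ENNReal.mul_ne_top (by simp) h2'.ne) hB).ennreal_toReal.aestronglyMeasurable
  have hωm : AEStronglyMeasurable ω (volume.restrict (Ioc t₀ t₁)) :=
    (eb_inner_meas w (ENNReal.ofReal (qdual q2 0)) (by simpa using hd0)
      ENNReal.ofReal_ne_top hw).ennreal_toReal.aestronglyMeasurable
  have key : ∀ t ∈ Ioc t₀ t₁,
      ∫⁻ x in Metric.ball 0 ρ, ENNReal.ofReal (‖B x t‖ ^ 2 * (w x t) ^ 2) ≤ ‖(ω • β) t‖ₑ ^ 2 := by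
    intro t ht
    have hBm : AEStronglyMeasurable (fun x => B x t) (volume.restrict (Metric.ball 0 ρ)) :=
      ((hBc t ht).mono Metric.ball_subset_closedBall).aestronglyMeasurable measurableSet_ball
    have hwm : AEStronglyMeasurable (fun x => w x t) (volume.restrict (Metric.ball 0 ρ)) :=
      ((hwc t ht).mono Metric.ball_subset_closedBall).aestronglyMeasurable measurableSet_ball
    have hol := eLpNorm_smul_le_mul_eLpNorm (r := 2) (p := ENNReal.ofReal (qdual q2 0))
      (q := 2 * q2) hBm hwm (hpqr := ENNReal.HolderTriple.symm)
    have e1 : ∫⁻ x in Metric.ball 0 ρ, ENNReal.ofReal (‖B x t‖ ^ 2 * (w x t) ^ 2)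
        = (eLpNorm ((fun x => w x t) • fun x => B x t) 2
            (volume.restrict (Metric.ball 0 ρ))) ^ 2 := by
      rw [eb_eLp2]
      refine lintegral_congr fun x => ?_
      rw [Pi.smul_apply', enorm_smul, ← ofReal_norm_eq_enorm, ← ofReal_norm_eq_enorm,
        ← ENNReal.ofReal_mul (norm_nonneg _), ← ENNReal.ofReal_pow (by positivity)]
      congr 1
      rw [mul_pow, Real.norm_eq_abs, sq_abs, mul_comm]
    rw [e1]
    have e2 : ‖(ω • β) t‖ₑ = eLpNorm (fun x => w x t) (ENNReal.ofReal (qdual q2 0))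
          (volume.restrict (Metric.ball 0 ρ))
        * eLpNorm (fun x => B x t) (2 * q2) (volume.restrict (Metric.ball 0 ρ)) := by
      rw [Pi.smul_apply', enorm_smul, Real.enorm_of_nonneg ENNReal.toReal_nonneg,
        Real.enorm_of_nonneg ENNReal.toReal_nonneg,
        ENNReal.ofReal_toReal (eb_inner_fin _ _ (hwc t ht)),
        ENNReal.ofReal_toReal (eb_inner_fin _ _ (hBc t ht))]
    rw [e2]
    gcongr
  have hol := eLpNorm_smul_le_mul_eLpNorm (r := 2) (p := ENNReal.ofReal (qdual q1 0))
      (q := 2 * q1) hβm hωm (hpqr := ENNReal.HolderTriple.symm)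
  calc _ ≤ ∫⁻ t in Ioc t₀ t₁, ‖(ω • β) t‖ₑ ^ 2 := setLIntegral_mono' measurableSet_Ioc key
    _ = (eLpNorm (ω • β) 2 (volume.restrict (Ioc t₀ t₁))) ^ 2 := (eb_eLp2 _ _).symm
    _ ≤ (eLpNorm ω (ENNReal.ofReal (qdual q1 0)) (volume.restrict (Ioc t₀ t₁))
          * eLpNorm β (2 * q1) (volume.restrict (Ioc t₀ t₁))) ^ 2 := by gcongr
    _ = _ := by rw [mul_pow, mul_comm]; rfl

namespace EbData
variable {d : ℕ} {m ρ t₀ t₁ μ k l : ℝ} {B : Rd d → ℝ → Rd d} {v ζ : Rd d → ℝ → ℝ}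

lemma set_id (h : EbData d m ρ t₀ t₁ μ k l B v ζ) {t : ℝ} (ht : t ∈ Icc t₀ t₁) (g : Rd d → ℝ) :
    ∫ x in {x : Rd d | x ∈ Metric.ball (0 : Rd d) ρ ∧ 0 < max (v x t - l) 0}, g x
      = ∫ x in Metric.ball 0 ρ, {y | l < v y t}.indicator g x := by
  have e : {x : Rd d | x ∈ Metric.ball (0 : Rd d) ρ ∧ 0 < max (v x t - l) 0}
      = Metric.ball 0 ρ ∩ {y | l < v y t} := by
    ext x
    simp
  rw [e, ← integral_indicator (h.open_set ht).measurableSet, ← integral_indicator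
    measurableSet_ball]
  rw [← indicator_indicator]

lemma hb_of (h : EbData d m ρ t₀ t₁ μ k l B v ζ)
    (hX : ∫⁻ t in Ioc t₀ t₁, ∫⁻ x in Metric.ball 0 ρ, ENNReal.ofReal (bI l B v ζ t x) ≠ ∞) :
    IntegrableOn (fun t => ∫ x in Metric.ball 0 ρ, bI l B v ζ t x) (Ioc t₀ t₁) ∧
    ENNReal.ofReal (∫ t in Ioc t₀ t₁, ∫ x in Metric.ball 0 ρ, bI l B v ζ t x)
      = ∫⁻ t in Ioc t₀ t₁, ∫⁻ x in Metric.ball 0 ρ, ENNReal.ofReal (bI l B v ζ t x) := by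
  have h0 : ∀ t, 0 ≤ ∫ x in Metric.ball 0 ρ, bI l B v ζ t x := fun t =>
    integral_nonneg fun x => bI_nonneg t x
  have e : ∫⁻ t in Ioc t₀ t₁, ENNReal.ofReal (∫ x in Metric.ball 0 ρ, bI l B v ζ t x)
      = ∫⁻ t in Ioc t₀ t₁, ∫⁻ x in Metric.ball 0 ρ, ENNReal.ofReal (bI l B v ζ t x) := by
    refine setLIntegral_congr_fun measurableSet_Ioc fun t ht => ?_
    exact ofReal_integral_eq_lintegral_ofReal (h.bI_int ht) (.of_forall fun x => bI_nonneg t x)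
  have hi : IntegrableOn (fun t => ∫ x in Metric.ball 0 ρ, bI l B v ζ t x) (Ioc t₀ t₁) := by
    refine (lintegral_ofReal_ne_top_iff_integrable (ebM_tmeas h.bI_meas) (.of_forall h0)).1 ?_
    rw [e]; exact hX
  exact ⟨hi, by rw [← e]; exact ofReal_integral_eq_lintegral_ofReal hi (.of_forall h0)⟩

lemma final (h : EbData d m ρ t₀ t₁ μ k l B v ζ) (hμ : 0 < μ) (qh1 qh2 : ℝ≥0∞) (h1 : 1 < qh1)
    (h2 : 1 < qh2) (h2' : qh2 < ∞) :
    ENNReal.ofReal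
            (μ ^ (-((m - 1) / m)) *
                (⨆ t ∈ Set.Icc t₀ t₁,
                  ∫ x in Metric.ball 0 ρ, (max (v x t - l) 0) ^ 2 * (ζ x t) ^ 2)
              + ∫ t in Set.Ioc t₀ t₁, ∫ x in Metric.ball 0 ρ,
                  ‖fderiv ℝ (fun y => max (v y t - l) 0 * ζ y t) x‖ ^ 2)
          ≤ ENNReal.ofReal ((5 * m + 12) * k ^ 2 * l ^ (-((m - 1) / m)) *
                ∫ t in Set.Ioc t₀ t₁,
                  ∫ x in {x : Rd d | x ∈ Metric.ball (0 : Rd d) ρ ∧ 0 < max (v x t - l) 0},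
                    |ζ x t * deriv (fun s => ζ x s) t|)
            + ENNReal.ofReal ((5 * m + 12) * k ^ 2 *
                ∫ t in Set.Ioc t₀ t₁,
                  ∫ x in {x : Rd d | x ∈ Metric.ball (0 : Rd d) ρ ∧ 0 < max (v x t - l) 0},
                    ‖fderiv ℝ (fun y => ζ y t) x‖ ^ 2)
            + ENNReal.ofReal ((5 * m + 12) * l ^ (-(2 * ((m - 1) / m))))
                * (mixedNorm (2 * qh1) (2 * qh2) B (Metric.ball 0 ρ) (Set.Ioc t₀ t₁)) ^ 2
                * (mixedNorm (ENNReal.ofReal (qdual qh1 0)) (ENNReal.ofReal (qdual qh2 0))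
                    (fun x t => max (v x t - l) 0 * ζ x t)
                    (Metric.ball 0 ρ) (Set.Ioc t₀ t₁)) ^ 2 := by
  have hm := h.hm
  have hl := h.hl
  have hk := h.hk
  set N := (mixedNorm (2 * qh1) (2 * qh2) B (Metric.ball 0 ρ) (Set.Ioc t₀ t₁)) ^ 2
    * (mixedNorm (ENNReal.ofReal (qdual qh1 0)) (ENNReal.ofReal (qdual qh2 0))
        (fun x t => max (v x t - l) 0 * ζ x t) (Metric.ball 0 ρ) (Set.Ioc t₀ t₁)) ^ 2 with hN
  rw [mul_assoc (ENNReal.ofReal _), ← hN]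
  have hc : 0 < (5 * m + 12) * l ^ (-(2 * ((m - 1) / m))) := by
    have := Real.rpow_pos_of_pos hl (-(2 * ((m - 1) / m)))
    positivity
  by_cases hNt : N = ∞
  · rw [hNt, ENNReal.mul_top (by simpa using hc)]
    simp
  have hX : ∫⁻ t in Ioc t₀ t₁, ∫⁻ x in Metric.ball 0 ρ, ENNReal.ofReal (bI l B v ζ t x) ≤ N := by
    refine eb_mixed B (fun x t => max (v x t - l) 0 * ζ x t) qh1 qh2 h1 h2 h2'
      (ebM_cont h.Bcont') (ebM_cont ?_) (fun t ht => h.Bcx ht) (fun t ht => ?_)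
    · exact ((h.vcont'.sub continuousOn_const).sup continuousOn_const).mul h.ζcont'.continuousOn
    · exact (((h.vcx (Ioc_subset_Icc_self ht)).sub continuousOn_const).sup continuousOn_const).mul
        (h.ζc t).continuousOn
  obtain ⟨hb, hbe⟩ := h.hb_of (ne_top_of_le_ne_top hNt hX)
  have hG := h.grad_term hb
  have hR := h.Rt_eq hb
  have hS : μ ^ (-((m - 1) / m)) * (⨆ t ∈ Set.Icc t₀ t₁,
      ∫ x in Metric.ball 0 ρ, (max (v x t - l) 0) ^ 2 * (ζ x t) ^ 2)
      ≤ 2 * m * ∫ t in Ioc t₀ t₁, Rt m ρ k l B v ζ t := by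
    have hR0 : 0 ≤ ∫ t in Ioc t₀ t₁, Rt m ρ k l B v ζ t := integral_nonneg fun t => h.Rt_nonneg t
    have hp := Real.rpow_pos_of_pos hμ (-((m - 1) / m))
    rw [mul_comm, ← le_div_iff₀ hp]
    have h0 : 0 ≤ (2 * m * ∫ t in Ioc t₀ t₁, Rt m ρ k l B v ζ t) / μ ^ (-((m - 1) / m)) := by
      positivity
    refine Real.iSup_le (fun t => Real.iSup_le (fun ht => ?_) h0) h0
    rw [le_div_iff₀ hp, mul_comm]
    exact h.sup_term hb ht
  have eT : ∫ t in Set.Ioc t₀ t₁,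
      ∫ x in {x : Rd d | x ∈ Metric.ball (0 : Rd d) ρ ∧ 0 < max (v x t - l) 0},
        |ζ x t * deriv (fun s => ζ x s) t|
      = ∫ t in Ioc t₀ t₁, ∫ x in Metric.ball 0 ρ, tI l v ζ t x :=
    setIntegral_congr_fun measurableSet_Ioc fun t ht => h.set_id (Ioc_subset_Icc_self ht) _
  have eG : ∫ t in Set.Ioc t₀ t₁,
      ∫ x in {x : Rd d | x ∈ Metric.ball (0 : Rd d) ρ ∧ 0 < max (v x t - l) 0},
        ‖fderiv ℝ (fun y => ζ y t) x‖ ^ 2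
      = ∫ t in Ioc t₀ t₁, ∫ x in Metric.ball 0 ρ, gI l v ζ t x :=
    setIntegral_congr_fun measurableSet_Ioc fun t ht => h.set_id (Ioc_subset_Icc_self ht) _
  rw [eT, eG]
  have hT0 : 0 ≤ ∫ t in Ioc t₀ t₁, ∫ x in Metric.ball 0 ρ, tI l v ζ t x :=
    integral_nonneg fun t => integral_nonneg fun x => tI_nonneg t x
  have hG0 : 0 ≤ ∫ t in Ioc t₀ t₁, ∫ x in Metric.ball 0 ρ, gI l v ζ t x :=
    integral_nonneg fun t => integral_nonneg fun x => gI_nonneg t x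
  have hB0 : 0 ≤ ∫ t in Ioc t₀ t₁, ∫ x in Metric.ball 0 ρ, bI l B v ζ t x :=
    integral_nonneg fun t => integral_nonneg fun x => bI_nonneg t x
  have hlam : (l ^ (-((m - 1) / m))) ^ 2 = l ^ (-(2 * ((m - 1) / m))) := by
    rw [← Real.rpow_natCast, ← Real.rpow_mul hl.le]
    congr 1; push_cast; ring
  have hlp := Real.rpow_pos_of_pos hl (-((m - 1) / m))
  rw [hlam] at hR
  rw [hR] at hS hG
  have hX2 : ENNReal.ofReal ((5 * m + 12) * l ^ (-(2 * ((m - 1) / m)))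
      * ∫ t in Ioc t₀ t₁, ∫ x in Metric.ball 0 ρ, bI l B v ζ t x)
      ≤ ENNReal.ofReal ((5 * m + 12) * l ^ (-(2 * ((m - 1) / m)))) * N := by
    rw [ENNReal.ofReal_mul hc.le, hbe]
    gcongr
  refine le_trans ?_ (add_le_add_right hX2 _)
  have hlp2 := Real.rpow_pos_of_pos hl (-(2 * ((m - 1) / m)))
  rw [← ENNReal.ofReal_add (by positivity) (by positivity),
    ← ENNReal.ofReal_add (by positivity) (by positivity)]
  apply ENNReal.ofReal_le_ofReal
  generalize (∫ t in Ioc t₀ t₁, ∫ x in Metric.ball 0 ρ, bI l B v ζ t x) = X at *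
  generalize (∫ t in Ioc t₀ t₁, ∫ x in Metric.ball 0 ρ, gI l v ζ t x) = G at *
  generalize (∫ t in Ioc t₀ t₁, ∫ x in Metric.ball 0 ρ, tI l v ζ t x) = T at *
  have a1 : 0 ≤ l ^ (-((m - 1) / m)) * k ^ 2 * T := by positivity
  have a2 : 0 ≤ l ^ (-(2 * ((m - 1) / m))) * X := by positivity
  have a3 : 0 ≤ k ^ 2 * G := by positivity
  generalize l ^ (-((m - 1) / m)) = A at *
  generalize l ^ (-(2 * ((m - 1) / m))) = A2 at *
  have b1 : 0 ≤ m * (A * k ^ 2 * T) := by positivity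
  have b2 : 0 ≤ m * (A2 * X) := by positivity
  have b3 : 0 ≤ m * (k ^ 2 * G) := by positivity
  refine (add_le_add hS hG).trans ?_
  nlinarith
end EbData

lemma eb_divg_smul {d : ℕ} {w : Rd d → ℝ} {F : Rd d → Rd d} {x : Rd d}
    (hw : DifferentiableAt ℝ w x) (hF : DifferentiableAt ℝ F x) :
    divg d (fun y => w y • F y) x = w x * divg d F x + fderiv ℝ w x (F x) := by
  unfold divg
  rw [eb_clm_apply (fderiv ℝ w x) (F x), Finset.mul_sum, ← Finset.sum_add_distrib]
  refine Finset.sum_congr rfl fun i _ => ?_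
  have hFi : DifferentiableAt ℝ (fun y => F y i) x := by
    exact (EuclideanSpace.proj i : Rd d →L[ℝ] ℝ).differentiableAt.comp x hF
  have := eb_pd_mul hw hFi i
  simpa [pd] using this

lemma eb_vder {d : ℕ} {m : ℝ} (hm : 1 ≤ m) {v : Rd d → ℝ → ℝ} {b : Rd d → Rd d} {x : Rd d} {t : ℝ}
    (hpos : ∀ᶠ s in 𝓝 t, 0 < v x s) (hv : DifferentiableAt ℝ (fun y => v y t) x)
    (hb : DifferentiableAt ℝ b x) (hdiv : divg d b x = 0)
    (hd : DifferentiableAt ℝ (fun s => v x s ^ (1 / m)) t)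
    (he : deriv (fun s => v x s ^ (1 / m)) t
      = lap d (fun y => v y t) x + divg d (fun y => (v y t ^ (1 / m)) • b y) x) :
    HasDerivAt (fun s => v x s) (m * v x t ^ ((m - 1) / m) * lap d (fun y => v y t) x
        + fderiv ℝ (fun y => v y t) x (b x)) t := by
  have hm0 : 0 < m := by linarith
  have hvt : 0 < v x t := hpos.self_of_nhds
  have h1 : HasDerivAt (fun s => (v x s ^ (1 / m)) ^ m)
      (deriv (fun s => v x s ^ (1 / m)) t * m * (v x t ^ (1 / m)) ^ (m - 1)) t :=
    hd.hasDerivAt.rpow_const (Or.inl (Real.rpow_pos_of_pos hvt _).ne')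
  have h2 : (fun s => v x s) =ᶠ[𝓝 t] fun s => (v x s ^ (1 / m)) ^ m := by
    filter_upwards [hpos] with s hs
    rw [← Real.rpow_mul hs.le, one_div, inv_mul_cancel₀ hm0.ne', Real.rpow_one]
  refine (h1.congr_of_eventuallyEq h2).congr_deriv ?_
  have hw : HasFDerivAt (fun y => v y t ^ (1 / m))
      ((1 / m * v x t ^ (1 / m - 1)) • fderiv ℝ (fun y => v y t) x) x :=
    hv.hasFDerivAt.rpow_const (Or.inl hvt.ne')
  rw [he, eb_divg_smul hw.differentiableAt hb, hdiv, hw.fderiv, ← Real.rpow_mul hvt.le]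
  have e1 : 1 / m * (m - 1) = (m - 1) / m := by ring
  have e2 : v x t ^ (1 / m - 1) * v x t ^ ((m - 1) / m) = 1 := by
    rw [← Real.rpow_add hvt]
    have : 1 / m - 1 + (m - 1) / m = 0 := by field_simp; ring
    rw [this, Real.rpow_zero]
  rw [e1]
  simp only [mul_zero, zero_add, FunLike.coe_smul, Pi.smul_apply, smul_eq_mul]
  have e3 : 1 / m * v x t ^ (1 / m - 1) * m * v x t ^ ((m - 1) / m) = 1 := by
    have e4 : 1 / m * m = 1 := by field_simp
    linear_combination (v x t ^ (1 / m - 1) * v x t ^ ((m - 1) / m)) * e4 + e2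
  linear_combination (fderiv ℝ (fun y => v y t) x (b x)) * e3

lemma eb_build {d : ℕ} {m : ℝ} (hm : 1 ≤ m) {ρ t₀ t₁ : ℝ} (hρ : 0 < ρ) (hρ' : ρ < 1 / 2)
    (ht : t₀ < t₁) (hQ : (Kball d ρ ×ˢ Set.Ioc t₀ t₁) ⊆ Q1S d) {B : Rd d → ℝ → Rd d}
    (hB : IsC1VF d B) (hdiv : DivFree d B) {v : Rd d → ℝ → ℝ}
    (hv : IsClassicalSolV d m B v (Kball d ρ) (Set.Ioc t₀ t₁)) {μp μm : ℝ}
    (hp : μp = supOn d v (Kball d ρ ×ˢ Set.Ioc t₀ t₁))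
    (hmm : μm = infOn d v (Kball d ρ ×ˢ Set.Ioc t₀ t₁)) {k : ℝ} (hk : μm < k) (hk' : k < μp)
    {ζ : Rd d → ℝ → ℝ} (hζ : ContDiff ℝ (⊤ : ℕ∞) (fun p : Rd d × ℝ => ζ p.1 p.2))
    (hζ01 : ∀ x t, 0 ≤ ζ x t ∧ ζ x t ≤ 1)
    (hζs : ∀ x ∈ Metric.sphere (0 : Rd d) ρ, ∀ t ∈ Set.Icc t₀ t₁, ζ x t = 0)
    (hζi : ∀ x ∈ closure (Kball d ρ), ζ x t₀ = 0) :
    EbData d m ρ t₀ t₁ μp k (μp - k) B v ζ := by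
  unfold Kball at *
  obtain ⟨vpos, vcont, vC2, vd, ve⟩ := hv
  have hcl : closure (Metric.ball (0 : Rd d) ρ ×ˢ Ioc t₀ t₁)
      = Metric.closedBall 0 ρ ×ˢ Icc t₀ t₁ := by
    rw [closure_prod_eq, closure_ball _ hρ.ne', closure_Ioc ht.ne]
  rw [closure_ball _ hρ.ne'] at hζi
  have hμm : 0 ≤ μm := by
    rw [hmm]
    refine Real.sInf_nonneg ?_
    rintro _ ⟨p, hp, rfl⟩
    exact (vpos _ hp.1 _ hp.2).le
  have hIoc : ∀ t ∈ Ioc t₀ t₁, t ∈ Ioc (-1 : ℝ) 0 := fun t h =>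
    (hQ (show ((0 : Rd d), t) ∈ _ from ⟨Metric.mem_ball_self hρ, h⟩)).2
  have hle : ∀ p ∈ Metric.closedBall (0 : Rd d) ρ ×ˢ Icc t₀ t₁, v p.1 p.2 ≤ μp := by
    have hcomp : IsCompact (Metric.closedBall (0 : Rd d) ρ ×ˢ Icc t₀ t₁) :=
      (isCompact_closedBall _ _).prod isCompact_Icc
    rw [hcl] at vcont
    have hbd := hcomp.bddAbove_image vcont
    have hsub : Metric.ball (0 : Rd d) ρ ×ˢ Ioc t₀ t₁ ⊆ Metric.closedBall 0 ρ ×ˢ Icc t₀ t₁ :=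
      prod_mono Metric.ball_subset_closedBall Ioc_subset_Icc_self
    have h1 : ∀ p ∈ Metric.ball (0 : Rd d) ρ ×ˢ Ioc t₀ t₁, v p.1 p.2 ≤ μp := by
      intro p hp'
      rw [hp]
      exact le_csSup (hbd.mono (image_mono hsub)) ⟨p, hp', rfl⟩
    intro p hpp
    rw [← hcl] at hpp vcont
    exact le_of_tendsto_of_frequently ((vcont p hpp).mono_left
      (nhdsWithin_mono _ subset_closure) : Tendsto _ (𝓝[Metric.ball (0 : Rd d) ρ ×ˢ Ioc t₀ t₁] p) _)
      (by
        haveI : (𝓝[Metric.ball (0 : Rd d) ρ ×ˢ Ioc t₀ t₁] p).NeBot :=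
          mem_closure_iff_nhdsWithin_neBot.1 hpp
        exact (eventually_mem_nhdsWithin.mono h1).frequently)
  have hBC : ∀ t ∈ Ioc t₀ t₁, ContDiffOn ℝ 1 (fun x => B x t) (Metric.ball 0 ρ) := by
    intro t h
    exact hB.comp (f := fun x : Rd d => (x, t)) (by fun_prop) fun x hx => hQ ⟨hx, h⟩
  have hd0 : ∀ t ∈ Ioc t₀ t₁, ∀ x ∈ Metric.ball (0 : Rd d) ρ, divg d (fun y => B y t) x = 0 :=
    fun t h x hx => hdiv t (hIoc t h) x (Metric.ball_subset_ball (by linarith) hx)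
  refine ⟨hm, hρ, ht, by linarith, by linarith, rfl, vpos, hcl ▸ vcont, vC2, ?_,
    fun x hx t h => hle (x, t) ⟨hx, h⟩, ?_, hBC, hd0, hζ, fun x t => (hζ01 x t).1,
    fun x t => (hζ01 x t).2, hζs, hζi⟩
  · intro x hx t h
    have h' := Ioo_subset_Ioc_self h
    have hn := Metric.isOpen_ball.mem_nhds hx
    refine eb_vder hm (b := fun y => B y t) ?_ ?_ ?_ (hd0 t h' x hx) (vd x hx t h') (ve x hx t h')
    · filter_upwards [isOpen_Ioo.mem_nhds h] with s hs
      exact vpos x hx s (Ioo_subset_Ioc_self hs)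
    · exact ((vC2 t h').contDiffAt hn).differentiableAt (by norm_num)
    · exact ((hBC t h').contDiffAt hn).differentiableAt (by norm_num)
  · refine hB.continuousOn.mono ?_
    rintro ⟨x, t⟩ ⟨hx, h⟩
    exact ⟨Metric.closedBall_subset_ball (by linarith) hx, hIoc t h⟩

end Aux

/-- Proposition 3.2, energy estimate for divergence-free drift
in the critical regime. -/
theorem energy_estimate_critical_divfree (m : ℝ) (hm : 1 ≤ m) :
    ∃ C : ℝ, 0 < C ∧
      ∀ d : ℕ, 1 ≤ d →
      ∀ qh1 qh2 : ℝ≥0∞, 1 < qh1 → 1 < qh2 → qh2 < ∞ →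
        2 / qh1 + (d : ℝ≥0∞) / qh2 = 2 →
      ∀ ρ t₀ t₁ : ℝ, 0 < ρ → ρ < 1/2 → t₀ < t₁ →
        (Kball d ρ ×ˢ Set.Ioc t₀ t₁) ⊆ Q1S d →
      ∀ B : Rd d → ℝ → Rd d, IsC1VF d B → DivFree d B →
      ∀ v : Rd d → ℝ → ℝ,
        IsClassicalSolV d m B v (Kball d ρ) (Set.Ioc t₀ t₁) →
      ∀ μp μm : ℝ,
        μp = supOn d v (Kball d ρ ×ˢ Set.Ioc t₀ t₁) →
        μm = infOn d v (Kball d ρ ×ˢ Set.Ioc t₀ t₁) →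
      ∀ k : ℝ, μm < k → k < μp →
      ∀ ζ : Rd d → ℝ → ℝ,
        ContDiff ℝ (⊤ : ℕ∞) (fun p : Rd d × ℝ => ζ p.1 p.2) →
        (∀ x t, 0 ≤ ζ x t ∧ ζ x t ≤ 1) →
        (∀ x ∈ Metric.sphere (0 : Rd d) ρ, ∀ t ∈ Set.Icc t₀ t₁, ζ x t = 0) →
        (∀ x ∈ closure (Kball d ρ), ζ x t₀ = 0) →
        ENNReal.ofReal
            (μp ^ (-((m - 1) / m)) *
                (⨆ t ∈ Set.Icc t₀ t₁,
                  ∫ x in Kball d ρ, (max (v x t - (μp - k)) 0) ^ 2 * (ζ x t) ^ 2)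
              + ∫ t in Set.Ioc t₀ t₁, ∫ x in Kball d ρ,
                  ‖fderiv ℝ (fun y => max (v y t - (μp - k)) 0 * ζ y t) x‖ ^ 2)
          ≤ ENNReal.ofReal (C * k ^ 2 * (μp - k) ^ (-((m - 1) / m)) *
                ∫ t in Set.Ioc t₀ t₁,
                  ∫ x in {x : Rd d | x ∈ Kball d ρ ∧ 0 < max (v x t - (μp - k)) 0},
                    |ζ x t * deriv (fun s => ζ x s) t|)
            + ENNReal.ofReal (C * k ^ 2 *
                ∫ t in Set.Ioc t₀ t₁,
                  ∫ x in {x : Rd d | x ∈ Kball d ρ ∧ 0 < max (v x t - (μp - k)) 0},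
                    ‖fderiv ℝ (fun y => ζ y t) x‖ ^ 2)
            + ENNReal.ofReal (C * (μp - k) ^ (-(2 * ((m - 1) / m))))
                * (mixedNorm (2 * qh1) (2 * qh2) B (Kball d ρ) (Set.Ioc t₀ t₁)) ^ 2
                * (mixedNorm (ENNReal.ofReal (qdual qh1 0)) (ENNReal.ofReal (qdual qh2 0))
                    (fun x t => max (v x t - (μp - k)) 0 * ζ x t)
                    (Kball d ρ) (Set.Ioc t₀ t₁)) ^ 2 := by
  refine ⟨5 * m + 12, by linarith, ?_⟩
  intro d _ qh1 qh2 h1 h2 h2' _ ρ t₀ t₁ hρ hρ' ht hQ B hB hdiv v hv μp μm hp hmm k hk hk' ζ hζ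
    hζ01 hζs hζi
  have h := eb_build hm hρ hρ' ht hQ hB hdiv hv hp hmm hk hk' hζ hζ01 hζs hζi
  have hμ : 0 < μp := h.hk.trans hk'
  exact h.final hμ qh1 qh2 h1 h2 h2'

end
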